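/- Uniform approximation of viscosity solutions by DPP solutions (Lemma 5.4): let u be a continuous viscosity solution of −Δ_p^N u = f in Ω, where f : \bar{Ω} → ℝ is continuous, bounded and positive, and suppose B_{2R}(0) ⊂ Ω for some R > 0. For each ε ∈ (0, R), let Γ_ε^R = {x ∈ Ω \\ B_R(0) : dist(x, ∂B_R(0)) ≤ ε}, and let u_ε be the unique bounded Borel measurable function on B_R(0) ∪ Γ_ε^R that equals u on Γ_ε^R and satisfies u_ε(x) = (α/2)(sup_{B_ε(x)} u_ε + inf_{B_ε(x)} u_ε) + β ⨍_{B_ε(x)} u_ε(y) dy + ε² \bar{f}(x) for every x ∈ B_R(0), where \bar{f} = (pβ/(2(n+2))) f. Then u_ε → u uniformly on \bar{B}_R(0) as ε → 0. -/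

import Mathlib

open MeasureTheory Metric Set Filter ProbabilityTheory

noncomputable section

/-- Euclidean space `ℝⁿ`. -/
abbrev En (n : ℕ) := EuclideanSpace ℝ (Fin n)

/-- The boundary strip `Γ_ε = {x ∈ ℝⁿ \ Ω : dist(x, ∂Ω) ≤ ε}`. -/
def bdryStrip (n : ℕ) (Ω : Set (En n)) (ε : ℝ) : Set (En n) :=
  {x | x ∉ Ω ∧ Metric.infDist x (frontier Ω) ≤ ε}

/-- The dynamic programming principle (DPP) with running payoff `f`:
`u x = (α/2)(sup_{B_ε(x)} u + inf_{B_ε(x)} u) + β ⨍_{B_ε(x)} u + ε² f x` for all `x ∈ Ω`. -/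
def SatisfiesDPP (n : ℕ) (α β ε : ℝ) (Ω : Set (En n)) (f u : En n → ℝ) : Prop :=
  ∀ x ∈ Ω, u x =
    α / 2 * (sSup (u '' Metric.ball x ε) + sInf (u '' Metric.ball x ε))
      + β * (⨍ y in Metric.ball x ε, u y) + ε ^ 2 * f x
open scoped Classical

/-- The second derivative of `φ` at `x` evaluated at the pair `(v, w)`. -/
def secondDeriv (n : ℕ) (φ : En n → ℝ) (x v w : En n) : ℝ :=
  fderiv ℝ (fderiv ℝ φ) x v w

/-- The Laplacian of `φ` at `x` (trace of the second derivative in the standard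
orthonormal basis of `ℝⁿ`). -/
def laplacian (n : ℕ) (φ : En n → ℝ) (x : En n) : ℝ :=
  ∑ i : Fin n,
    secondDeriv n φ x (EuclideanSpace.basisFun (Fin n) ℝ i)
      (EuclideanSpace.basisFun (Fin n) ℝ i)

/-- The normalized `p`-Laplacian
`Δ_p^N φ(x) = (1/p)((p−2)⟨D²φ(x)∇φ(x), ∇φ(x)⟩/|∇φ(x)|² + Δφ(x))` when `∇φ(x) ≠ 0`,
and `0` when `∇φ(x) = 0` (in particular when also `D²φ(x) = 0`). -/
def normalizedPLaplacian (n : ℕ) (p : ℝ) (φ : En n → ℝ) (x : En n) : ℝ :=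
  if gradient φ x = 0 then 0
  else (1 / p) * ((p - 2) * secondDeriv n φ x (gradient φ x) (gradient φ x)
    / ‖gradient φ x‖ ^ 2 + laplacian n φ x)

/-- `u` is a viscosity solution of `−Δ_p^N u = f` in `Ω`: `u` is continuous on `Ω`, and the
test-function inequalities hold for `C²` test functions `φ` touching `u` from below/above
at points of `Ω`, with `∇φ(x) ≠ 0` or `D²φ(x) = 0`. -/
def IsViscositySolution (n : ℕ) (p : ℝ) (Ω : Set (En n)) (f u : En n → ℝ) : Prop :=
  ContinuousOn u Ω ∧
  (∀ x ∈ Ω, ∀ φ : En n → ℝ, ContDiffAt ℝ 2 φ x → φ x = u x →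
    (∀ᶠ y in nhds x, φ y ≤ u y) →
    (gradient φ x ≠ 0 ∨ fderiv ℝ (fderiv ℝ φ) x = 0) →
    f x ≤ -normalizedPLaplacian n p φ x) ∧
  (∀ x ∈ Ω, ∀ φ : En n → ℝ, ContDiffAt ℝ 2 φ x → φ x = u x →
    (∀ᶠ y in nhds x, u y ≤ φ y) →
    (gradient φ x ≠ 0 ∨ fderiv ℝ (fderiv ℝ φ) x = 0) →
    -normalizedPLaplacian n p φ x ≤ f x)

/-- The boundary strip of the ball `B_R(0)` inside `Ω`:
`Γ_ε^R = {x ∈ Ω \ B_R(0) : dist(x, ∂B_R(0)) ≤ ε}`. -/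
def ballStrip (n : ℕ) (Ω : Set (En n)) (R ε : ℝ) : Set (En n) :=
  {x | x ∈ Ω ∧ x ∉ Metric.ball (0 : En n) R ∧
    Metric.infDist x (Metric.sphere (0 : En n) R) ≤ ε}

open scoped RealInnerProductSpace Topology

section Semiconcave

variable {E : Type*} [NormedAddCommGroup E] [InnerProductSpace ℝ E]

/-- `P` selects bounded supergradients of the semiconcave function `U`. -/
structure IsSemiconcaveWith (U : E → ℝ) (P : E → E) (C L : ℝ) : Prop where
  upper : ∀ x y, U y ≤ U x + ⟪P x, y - x⟫ + C / 2 * ‖y - x‖ ^ 2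
  bound : ∀ x, ‖P x‖ ≤ L

/-- A function on `[0, 1]` whose increments are at most `a` times the step, up to a quadratic
error, increases by at most `a`. -/
lemma sub_le_of_quadratic_increment {d : ℝ → ℝ} {a C : ℝ}
    (h : ∀ s t, 0 ≤ s → s ≤ t → t ≤ 1 → d t - d s ≤ a * (t - s) + C * (t - s) ^ 2) :
    d 1 - d 0 ≤ a := by
  have key : ∀ m : ℕ, d 1 - d 0 ≤ a + C * (1 / ((m : ℝ) + 1)) := by
    intro m
    have hm : (0 : ℝ) < (m : ℝ) + 1 := by positivity
    have hs := Finset.sum_range_sub (fun i : ℕ => d ((i : ℝ) / ((m : ℝ) + 1))) (m + 1)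
    have h1 : (((m + 1 : ℕ) : ℝ)) / ((m : ℝ) + 1) = 1 := by
      push_cast; exact div_self hm.ne'
    simp only [h1, Nat.cast_zero, zero_div] at hs
    rw [← hs]
    calc _ ≤ ∑ _i ∈ Finset.range (m + 1),
          (a * (1 / ((m : ℝ) + 1)) + C * (1 / ((m : ℝ) + 1)) ^ 2) := by
          refine Finset.sum_le_sum fun i hi => ?_
          have hi' : (i : ℝ) + 1 ≤ (m : ℝ) + 1 := by
            have := Finset.mem_range.1 hi
            exact_mod_cast this
          have hd : ((i + 1 : ℕ) : ℝ) / ((m : ℝ) + 1) - (i : ℝ) / ((m : ℝ) + 1)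
              = 1 / ((m : ℝ) + 1) := by
            push_cast; field_simp; ring
          have := h ((i : ℝ) / ((m : ℝ) + 1)) (((i + 1 : ℕ) : ℝ) / ((m : ℝ) + 1))
            (by positivity) (by push_cast; gcongr; linarith)
            (by push_cast; rw [div_le_one hm]; exact hi')
          rwa [hd] at this
      _ = _ := by
          rw [Finset.sum_const, Finset.card_range, nsmul_eq_mul]
          push_cast
          field_simp
  have hlim : Tendsto (fun m : ℕ => a + C * (1 / ((m : ℝ) + 1))) atTop (𝓝 (a + C * 0)) :=
    tendsto_const_nhds.add (tendsto_const_nhds.mul tendsto_one_div_add_atTop_nhds_zero_nat)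
  have := ge_of_tendsto' hlim key
  simpa using this

namespace IsSemiconcaveWith

variable {U : E → ℝ} {P : E → E} {C L : ℝ}

lemma bound_nonneg (h : IsSemiconcaveWith U P C L) : 0 ≤ L :=
  (norm_nonneg _).trans (h.bound 0)

lemma inner_sub_le (h : IsSemiconcaveWith U P C L) (x y : E) :
    ⟪P y - P x, y - x⟫ ≤ C * ‖y - x‖ ^ 2 := by
  have h1 := h.upper x y
  have h2 := h.upper y x
  rw [norm_sub_rev x y, ← neg_sub y x, inner_neg_right] at h2
  rw [inner_sub_left]
  linarith

lemma sub_le (h : IsSemiconcaveWith U P C L) (x y : E) : U y - U x ≤ L * ‖y - x‖ := by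
  have := sub_le_of_quadratic_increment (d := fun t => U (x + t • (y - x)))
    (a := L * ‖y - x‖) (C := C / 2 * ‖y - x‖ ^ 2) ?_
  · simpa using this
  intro s t _ hst _
  have h1 := h.upper (x + s • (y - x)) (x + t • (y - x))
  have h2 : x + t • (y - x) - (x + s • (y - x)) = (t - s) • (y - x) := by module
  rw [h2, norm_smul, inner_smul_right, Real.norm_of_nonneg (sub_nonneg.2 hst)] at h1
  have h3 : ⟪P (x + s • (y - x)), y - x⟫ ≤ L * ‖y - x‖ :=
    (real_inner_le_norm _ _).trans (mul_le_mul_of_nonneg_right (h.bound _) (norm_nonneg _))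
  have h4 := mul_le_mul_of_nonneg_left h3 (sub_nonneg.2 hst)
  nlinarith

lemma abs_sub_le (h : IsSemiconcaveWith U P C L) (x y : E) : |U y - U x| ≤ L * ‖y - x‖ := by
  rw [abs_sub_le_iff]
  exact ⟨h.sub_le x y, by rw [norm_sub_rev]; exact h.sub_le y x⟩

lemma lipschitzWith (h : IsSemiconcaveWith U P C L) : LipschitzWith (Real.toNNReal L) U := by
  refine LipschitzWith.of_dist_le_mul fun x y => ?_
  rw [Real.dist_eq, dist_eq_norm, Real.coe_toNNReal _ h.bound_nonneg]
  exact h.abs_sub_le y x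

lemma hasFDerivAt_of_differentiableAt (h : IsSemiconcaveWith U P C L) {x : E}
    (hx : DifferentiableAt ℝ U x) : HasFDerivAt U (innerSL ℝ (P x)) x := by
  have hq : HasFDerivAt (fun y => ⟪P x, y - x⟫ + C / 2 * ‖y - x‖ ^ 2) (innerSL ℝ (P x)) x := by
    have h1 : HasFDerivAt (fun y : E => y - x) (ContinuousLinearMap.id ℝ E) x :=
      (hasFDerivAt_id x).sub_const x
    have h2 : HasFDerivAt (fun y => ⟪P x, y - x⟫) (innerSL ℝ (P x)) x :=
      ((hasFDerivAt_const (P x) x).inner ℝ h1).congr_fderiv (by ext v; simp)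
    have h3 := (h1.norm_sq).const_mul (C / 2)
    exact (h2.add h3).congr_fderiv (by ext v; simp)
  have hmax : IsLocalMax (fun y => U y - (⟪P x, y - x⟫ + C / 2 * ‖y - x‖ ^ 2)) x := by
    refine Eventually.of_forall fun y => ?_
    have := h.upper x y
    simp only [sub_self, inner_zero_right, norm_zero]
    linarith
  have h0 := hmax.hasFDerivAt_eq_zero (hx.hasFDerivAt.sub hq)
  rw [sub_eq_zero] at h0
  exact h0 ▸ hx.hasFDerivAt

lemma continuousAt_of_differentiableAt (h : IsSemiconcaveWith U P C L) {x : E}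
    (hx : DifferentiableAt ℝ U x) : ContinuousAt P x := by
  rw [Metric.continuousAt_iff]
  intro ε hε
  have hd := h.hasFDerivAt_of_differentiableAt hx
  have hlo := hd.isLittleO.def (c := ε / 8) (by positivity)
  obtain ⟨δ, hδ, hball⟩ := Metric.eventually_nhds_iff.1 hlo
  set t : ℝ := min (δ / 2) (ε / (4 * (|C| + 1))) with ht
  have ht0 : 0 < t := by
    have : 0 < |C| + 1 := by positivity
    exact lt_min (by positivity) (by positivity)
  have hCt : C * t ≤ ε / 4 := by
    have h1 : t ≤ ε / (4 * (|C| + 1)) := min_le_right _ _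
    have h2 : (0 : ℝ) < |C| + 1 := by positivity
    rw [le_div_iff₀ (by positivity)] at h1
    nlinarith [le_abs_self C]
  refine ⟨min (t / 2) (δ / 2), by positivity, fun {y} hy => ?_⟩
  rw [dist_eq_norm] at hy ⊢
  by_cases hq : P y - P x = 0
  · simpa [hq] using hε
  have hn : 0 < ‖P y - P x‖ := norm_pos_iff.2 hq
  have hy1 := lt_of_lt_of_le hy (min_le_left _ _)
  have hy2 := lt_of_lt_of_le hy (min_le_right _ _)
  set e : E := (‖P y - P x‖)⁻¹ • (P y - P x) with he
  have hne : ‖e‖ = 1 := by rw [he, norm_smul, norm_inv, norm_norm, inv_mul_cancel₀ hn.ne']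
  have hie : ⟪P y, e⟫ - ⟪P x, e⟫ = ‖P y - P x‖ := by
    rw [← inner_sub_left, he, inner_smul_right, real_inner_self_eq_norm_sq]
    field_simp
  have hte : ‖t • e‖ = t := by rw [norm_smul, hne, mul_one, Real.norm_of_nonneg ht0.le]
  have hz : ‖y - t • e - x‖ ≤ ‖y - x‖ + t := by
    rw [show y - t • e - x = (y - x) - t • e by abel]
    exact (norm_sub_le _ _).trans (by rw [hte])
  have htδ : t ≤ δ / 2 := min_le_left _ _
  have h1 := hball (y := y) (by rw [dist_eq_norm]; linarith)
  have h2 := hball (y := y - t • e) (by rw [dist_eq_norm]; linarith)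
  simp only [innerSL_apply_apply, Real.norm_eq_abs] at h1 h2
  have h1' := (abs_le.1 h1).2
  have h2' := (abs_le.1 h2).1
  have h3 := h.upper y (y - t • e)
  rw [show y - t • e - y = -(t • e) by abel, norm_neg, hte, inner_neg_right,
    inner_smul_right] at h3
  rw [show y - t • e - x = (y - x) - t • e by abel, inner_sub_right, inner_smul_right] at h2'
  rw [show y - t • e - x = (y - x) - t • e by abel] at hz
  have h4 : t * ‖P y - P x‖ ≤ ε / 8 * (2 * ‖y - x‖ + t) + C / 2 * t ^ 2 := by
    rw [← hie]; nlinarith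
  have h5 : t * ‖P y - P x‖ ≤ t * (ε / 2) := by nlinarith
  have := le_of_mul_le_mul_left h5 ht0
  linarith

/-- Second-order lower expansion of a semiconcave function at a point where its supergradient
selection is differentiable. -/
lemma eventually_lower_expansion (h : IsSemiconcaveWith U P C L) {x : E} {A : E →L[ℝ] E}
    (hA : HasFDerivAt P A x) {θ : ℝ} (hθ : 0 < θ) :
    ∀ᶠ v in 𝓝 (0 : E), U x + ⟪P x, v⟫ + 1 / 2 * ⟪A v, v⟫ - θ * ‖v‖ ^ 2 ≤ U (x + v) := by
  have hlo := hA.isLittleO.def (c := θ) hθ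
  obtain ⟨δ, hδ, hball⟩ := Metric.eventually_nhds_iff.1 hlo
  refine Metric.eventually_nhds_iff.2 ⟨δ, hδ, fun {v} hv => ?_⟩
  rw [dist_zero_right] at hv
  have := sub_le_of_quadratic_increment
    (d := fun t => t * ⟪P x, v⟫ + t ^ 2 / 2 * ⟪A v, v⟫ - U (x + t • v))
    (a := θ * ‖v‖ ^ 2) (C := C / 2 * ‖v‖ ^ 2 - 1 / 2 * ⟪A v, v⟫) ?_
  · simp only [one_smul, zero_smul, add_zero] at this
    linarith
  intro s t hs hst ht1
  have ht0 := hs.trans hst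
  have h1 := h.upper (x + t • v) (x + s • v)
  rw [show x + s • v - (x + t • v) = -((t - s) • v) by module, norm_neg, norm_smul,
    inner_neg_right, inner_smul_right, Real.norm_of_nonneg (sub_nonneg.2 hst)] at h1
  have htv : ‖t • v‖ = t * ‖v‖ := by rw [norm_smul, Real.norm_of_nonneg ht0]
  have h2 := hball (y := x + t • v) (by
    rw [dist_eq_norm, add_sub_cancel_left, htv]
    nlinarith [norm_nonneg v])
  rw [add_sub_cancel_left, htv, map_smul] at h2
  have h3 : -⟪P (x + t • v) - P x - t • A v, v⟫ ≤ θ * (t * ‖v‖) * ‖v‖ := by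
    rw [← inner_neg_left]
    refine (real_inner_le_norm _ _).trans ?_
    rw [norm_neg]
    exact mul_le_mul_of_nonneg_right h2 (norm_nonneg _)
  rw [inner_sub_left, inner_sub_left, real_inner_smul_left] at h3
  have h5 : θ * (t * ‖v‖) * ‖v‖ ≤ θ * ‖v‖ ^ 2 := by
    have : 0 ≤ θ * ‖v‖ ^ 2 := by positivity
    nlinarith
  have h4 := mul_le_mul_of_nonneg_left (h3.trans h5) (sub_nonneg.2 hst)
  nlinarith

variable [FiniteDimensional ℝ E] [MeasurableSpace E] [BorelSpace E]

lemma ae_differentiableAt (h : IsSemiconcaveWith U P C L) (μ : Measure E) [μ.IsAddHaarMeasure] :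
    ∀ᵐ x ∂μ, DifferentiableAt ℝ U x :=
  h.lipschitzWith.ae_differentiableAt

/-- Alexandrov's theorem: the supergradient selection of a semiconcave function is differentiable
almost everywhere. -/
lemma ae_differentiableAt_gradient (h : IsSemiconcaveWith U P C L) (μ : Measure E)
    [μ.IsAddHaarMeasure] : ∀ᵐ x ∂μ, DifferentiableAt ℝ P x := by
  set T : E → E := fun x => (C + 1) • x - P x with hT
  have hexp : ∀ x y, ‖x - y‖ ≤ ‖T x - T y‖ := by
    intro x y
    have h1 := h.inner_sub_le y x
    have h2 : T x - T y = (C + 1) • (x - y) - (P x - P y) := by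
      simp only [hT]; module
    have h3 : ‖x - y‖ ^ 2 ≤ ⟪T x - T y, x - y⟫ := by
      rw [h2, inner_sub_left, real_inner_smul_left, real_inner_self_eq_norm_sq]
      linarith
    have h4 := real_inner_le_norm (T x - T y) (x - y)
    by_cases hxy : ‖x - y‖ = 0
    · rw [hxy]; exact norm_nonneg _
    · have : 0 < ‖x - y‖ := lt_of_le_of_ne (norm_nonneg _) (Ne.symm hxy)
      nlinarith
  have hinj : Function.Injective T := by
    intro x y hxy
    have := hexp x y
    rw [hxy, sub_self, norm_zero] at this
    exact sub_eq_zero.1 (norm_le_zero_iff.1 this)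
  have hlip : LipschitzOnWith 1 (Function.invFun T) (Set.range T) := by
    refine LipschitzOnWith.of_dist_le_mul ?_
    rintro _ ⟨x, rfl⟩ _ ⟨y, rfl⟩
    rw [Function.leftInverse_invFun hinj, Function.leftInverse_invFun hinj, dist_eq_norm,
      dist_eq_norm, NNReal.coe_one, one_mul]
    exact hexp x y
  obtain ⟨J, hJ, hJe⟩ := hlip.extend_finite_dimension
  have hJT : ∀ x, J (T x) = x := fun x => by
    rw [← hJe (Set.mem_range_self x), Function.leftInverse_invFun hinj]
  have hN1 : μ (J '' {z | ¬ DifferentiableAt ℝ J z}) = 0 := by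
    have h0 : μ {z | ¬ DifferentiableAt ℝ J z} = 0 := hJ.ae_differentiableAt
    have hH := hJ.lipschitzOnWith (s := {z | ¬ DifferentiableAt ℝ J z})
    have hd : (0 : ℝ) ≤ Module.finrank ℝ E := Nat.cast_nonneg _
    have h2 := hH.hausdorffMeasure_image_le hd
    have h1 : (μH[Module.finrank ℝ E] : Measure E) {z | ¬ DifferentiableAt ℝ J z} = 0 := by
      have := Measure.isAddLeftInvariant_eq_smul (μH[Module.finrank ℝ E] : Measure E) μ
      rw [this, Measure.smul_apply, h0, smul_zero]
    rw [h1, mul_zero] at h2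
    have := Measure.isAddLeftInvariant_eq_smul μ (μH[Module.finrank ℝ E] : Measure E)
    rw [this, Measure.smul_apply, le_antisymm h2 zero_le, smul_zero]
  have hN2 : μ (J '' {z | DifferentiableAt ℝ J z ∧ (fderiv ℝ J z).det = 0}) = 0 :=
    addHaar_image_eq_zero_of_det_fderivWithin_eq_zero μ
      (f' := fderiv ℝ J) (fun z hz => hz.1.hasFDerivAt.hasFDerivWithinAt) (fun z hz => hz.2)
  filter_upwards [h.ae_differentiableAt μ, measure_eq_zero_iff_ae_notMem.1 hN1,
    measure_eq_zero_iff_ae_notMem.1 hN2] with x hxU hx1 hx2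
  have hdiff : DifferentiableAt ℝ J (T x) := by
    by_contra hcon
    exact hx1 ⟨T x, hcon, hJT x⟩
  have hdet : (fderiv ℝ J (T x)).det ≠ 0 := fun hcon => hx2 ⟨T x, ⟨hdiff, hcon⟩, hJT x⟩
  have hTc : ContinuousAt T x :=
    (continuousAt_id.const_smul _).sub (h.continuousAt_of_differentiableAt hxU)
  have hJd : HasFDerivAt J
      (((fderiv ℝ J (T x)).toContinuousLinearEquivOfDetNeZero hdet : E ≃L[ℝ] E) : E →L[ℝ] E)
      (T x) := by
    convert hdiff.hasFDerivAt using 1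
    ext v; rfl
  have hTd := HasFDerivAt.of_local_left_inverse hTc hJd (Eventually.of_forall hJT)
  have hP : P = fun y => (C + 1) • y - T y := by
    funext y; simp only [hT]; module
  rw [hP]
  exact (differentiableAt_id.const_smul _).sub hTd.differentiableAt

end IsSemiconcaveWith

end Semiconcave

section Mollifier

/-- A smooth radially decreasing probability density `ρ` on the unit ball whose gradient at `z` is
`-b z • z`. -/
structure IsRadialMollifier {n : ℕ} (ρ b : En n → ℝ) : Prop where
  smooth : ContDiff ℝ 2 ρ
  nonneg : ∀ z, 0 ≤ ρ z
  eq_zero : ∀ z, 1 ≤ ‖z‖ → ρ z = 0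
  integral_eq_one : ∫ z, ρ z = 1
  b_continuous : Continuous b
  b_neg : ∀ z, b (-z) = b z
  b_nonneg : ∀ z, 0 ≤ b z
  b_pos : ∀ z, ‖z‖ < 1 → 0 < b z
  b_eq_zero : ∀ z, 1 ≤ ‖z‖ → b z = 0
  fderiv_apply : ∀ z v, fderiv ℝ ρ z v = -(b z * ⟪z, v⟫)

lemma deriv_expNegInvGlue_of_nonpos {x : ℝ} (hx : x ≤ 0) : deriv expNegInvGlue x = 0 := by
  refine IsLocalMin.deriv_eq_zero (Eventually.of_forall fun y => ?_)
  rw [expNegInvGlue.zero_of_nonpos hx]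
  exact expNegInvGlue.nonneg y

lemma deriv_expNegInvGlue_pos {x : ℝ} (hx : 0 < x) : 0 < deriv expNegInvGlue x := by
  have h1 : HasDerivAt (fun y : ℝ => Real.exp (-y⁻¹)) (Real.exp (-x⁻¹) * -(-(x ^ 2)⁻¹)) x :=
    ((hasDerivAt_inv hx.ne').neg).exp
  have h2 : expNegInvGlue =ᶠ[𝓝 x] fun y : ℝ => Real.exp (-y⁻¹) := by
    filter_upwards [lt_mem_nhds hx] with y hy
    simp [expNegInvGlue, not_le.2 hy]
  rw [h2.deriv_eq, h1.deriv, neg_neg]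
  positivity

lemma exists_isRadialMollifier (n : ℕ) : ∃ ρ b : En n → ℝ, IsRadialMollifier ρ b := by
  set q : En n → ℝ := fun z => expNegInvGlue (1 - ‖z‖ ^ 2) with hq
  have hqs : ContDiff ℝ 2 q :=
    (expNegInvGlue.contDiff (n := 2)).comp (contDiff_const.sub (contDiff_norm_sq ℝ))
  have hq0 : ∀ z, 0 ≤ q z := fun z => expNegInvGlue.nonneg _
  have hqz : ∀ z, 1 ≤ ‖z‖ → q z = 0 := fun z hz =>
    expNegInvGlue.zero_of_nonpos (by nlinarith)
  have hsupp : HasCompactSupport q :=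
    HasCompactSupport.intro (isCompact_closedBall (0 : En n) 1) fun z hz => hqz z (by
      rw [mem_closedBall, dist_zero_right, not_le] at hz; exact hz.le)
  have hI : 0 < ∫ z, q z := by
    refine hqs.continuous.integral_pos_of_hasCompactSupport_nonneg_nonzero hsupp hq0 (x := 0) ?_
    have : 0 < q 0 := expNegInvGlue.pos_of_pos (by simp)
    exact this.ne'
  have hdc : Continuous (deriv expNegInvGlue) :=
    (expNegInvGlue.contDiff (n := 1)).continuous_deriv (by norm_num)
  set I := ∫ z, q z with hIdef
  refine ⟨fun z => I⁻¹ * q z, fun z => I⁻¹ * (2 * deriv expNegInvGlue (1 - ‖z‖ ^ 2)), ?_⟩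
  refine ⟨contDiff_const.mul hqs, fun z => mul_nonneg (inv_nonneg.2 hI.le) (hq0 z),
    fun z hz => by simp only [hqz z hz, mul_zero], ?_, ?_, fun z => by simp only [norm_neg],
    fun z => ?_, fun z hz => ?_, fun z hz => ?_, fun z v => ?_⟩
  · rw [integral_const_mul, inv_mul_cancel₀ hI.ne']
  · exact continuous_const.mul (continuous_const.mul
      (hdc.comp (continuous_const.sub (continuous_norm.pow 2))))
  · rcases le_or_gt (1 - ‖z‖ ^ 2) 0 with h | h
    · simp [deriv_expNegInvGlue_of_nonpos h]
    · have := deriv_expNegInvGlue_pos h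
      positivity
  · have := deriv_expNegInvGlue_pos (x := 1 - ‖z‖ ^ 2) (by nlinarith [norm_nonneg z])
    positivity
  · rw [deriv_expNegInvGlue_of_nonpos (by nlinarith)]; simp
  · have h1 : HasDerivAt expNegInvGlue (deriv expNegInvGlue (1 - ‖z‖ ^ 2)) (1 - ‖z‖ ^ 2) :=
      ((expNegInvGlue.contDiff (n := 1)).differentiable (by norm_num)).differentiableAt.hasDerivAt
    have h2 : HasFDerivAt (fun z : En n => 1 - ‖z‖ ^ 2) (-(2 • innerSL ℝ z)) z := by
      exact ((hasStrictFDerivAt_norm_sq z).hasFDerivAt.const_sub 1)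
    have h3 := (h1.comp_hasFDerivAt z h2).const_mul I⁻¹
    have h4 : fderiv ℝ (fun z => I⁻¹ * q z) z
        = I⁻¹ • deriv expNegInvGlue (1 - ‖z‖ ^ 2) • -(2 • innerSL ℝ z) := h3.fderiv
    rw [h4]
    simp
    ring

namespace IsRadialMollifier

variable {n : ℕ} {ρ b : En n → ℝ}

lemma hasCompactSupport (h : IsRadialMollifier ρ b) : HasCompactSupport ρ :=
  HasCompactSupport.intro (isCompact_closedBall (0 : En n) 1) fun z hz => h.eq_zero z (by
    rw [mem_closedBall, dist_zero_right, not_le] at hz; exact hz.le)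

lemma hasCompactSupport_b (h : IsRadialMollifier ρ b) : HasCompactSupport b :=
  HasCompactSupport.intro (isCompact_closedBall (0 : En n) 1) fun z hz => h.b_eq_zero z (by
    rw [mem_closedBall, dist_zero_right, not_le] at hz; exact hz.le)

lemma integrable (h : IsRadialMollifier ρ b) : Integrable ρ :=
  h.smooth.continuous.integrable_of_hasCompactSupport h.hasCompactSupport

lemma integrable_sub (h : IsRadialMollifier ρ b) (x : En n) : Integrable fun y => ρ (x - y) :=
  h.integrable.comp_sub_left x

lemma integral_sub (h : IsRadialMollifier ρ b) (x : En n) : ∫ y, ρ (x - y) = 1 := by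
  rw [integral_sub_left_eq_self (fun z => ρ z) volume x, h.integral_eq_one]

/-- The mass of the mollifier concentrates on slightly smaller balls. -/
lemma exists_radius (h : IsRadialMollifier ρ b) {τ : ℝ} (hτ : 0 < τ) :
    ∃ r, 0 < r ∧ r < 1 ∧ ∀ x, ∫ y, (ball x r)ᶜ.indicator (fun y => ρ (x - y)) y ≤ τ := by
  have hlim : Tendsto (fun k : ℕ => ∫ z, (ball (0 : En n) (1 - 1 / ((k : ℝ) + 2)))ᶜ.indicator ρ z)
      atTop (𝓝 (∫ _z : En n, (0 : ℝ))) := by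
    refine tendsto_integral_of_dominated_convergence ρ (fun k => ?_) h.integrable (fun k => ?_) ?_
    · exact h.integrable.aestronglyMeasurable.indicator measurableSet_ball.compl
    · refine Eventually.of_forall fun z => ?_
      rw [Real.norm_eq_abs]
      by_cases hz : z ∈ (ball (0 : En n) (1 - 1 / ((k : ℝ) + 2)))ᶜ
      · rw [indicator_of_mem hz, abs_of_nonneg (h.nonneg z)]
      · rw [indicator_of_notMem hz, abs_zero]; exact h.nonneg z
    · refine Eventually.of_forall fun z => ?_
      rcases lt_or_ge ‖z‖ 1 with hz | hz
      · have h1 : Tendsto (fun k : ℕ => 1 - 1 / ((k : ℝ) + 2)) atTop (𝓝 (1 - 0)) := by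
          refine tendsto_const_nhds.sub ?_
          have := tendsto_one_div_add_atTop_nhds_zero_nat (𝕜 := ℝ)
          have h2 := (tendsto_add_atTop_iff_nat 1).2 this
          refine h2.congr fun k => ?_
          push_cast; ring
        refine tendsto_const_nhds.congr' ?_
        filter_upwards [h1.eventually (lt_mem_nhds (by simpa using hz))] with k hk
        rw [indicator_of_notMem]
        rw [Set.notMem_compl_iff, mem_ball, dist_zero_right]
        exact hk
      · refine tendsto_const_nhds.congr fun k => ?_
        by_cases hz' : z ∈ (ball (0 : En n) (1 - 1 / ((k : ℝ) + 2)))ᶜ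
        · rw [indicator_of_mem hz', h.eq_zero z hz]
        · rw [indicator_of_notMem hz']
  rw [integral_zero] at hlim
  obtain ⟨k, hk⟩ := (hlim.eventually (gt_mem_nhds hτ)).exists
  have hk2 : (0 : ℝ) < (k : ℝ) + 2 := by positivity
  refine ⟨1 - 1 / ((k : ℝ) + 2), ?_, ?_, fun x => ?_⟩
  · rw [sub_pos, div_lt_one hk2]; linarith [(Nat.cast_nonneg k : (0 : ℝ) ≤ k)]
  · have : 0 < 1 / ((k : ℝ) + 2) := by positivity
    linarith
  · refine le_trans (le_of_eq ?_) hk.le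
    rw [← integral_sub_left_eq_self
      (fun z => (ball (0 : En n) (1 - 1 / ((k : ℝ) + 2)))ᶜ.indicator ρ z) volume x]
    congr 1 with y
    simp only [indicator, mem_compl_iff, mem_ball, dist_eq_norm, norm_sub_rev y x, sub_zero]

end IsRadialMollifier

end Mollifier

section Mollification

variable {n : ℕ} {ρ b : En n → ℝ}

/-- Convolution with the kernel `ρ`. -/
def mollify {n : ℕ} (ρ F : En n → ℝ) (x : En n) : ℝ := ∫ y, F y * ρ (x - y)

lemma mollify_eq_convolution (ρ F : En n → ℝ) :
    mollify ρ F = convolution F ρ (ContinuousLinearMap.mul ℝ ℝ) volume := rfl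

lemma mollify_add (ρ F : En n → ℝ) (x v : En n) :
    mollify ρ F (x + v) = ∫ y, F (y + v) * ρ (x - y) := by
  rw [mollify, ← integral_add_right_eq_self _ v]
  congr 1 with y
  rw [add_sub_add_right_eq_sub]

namespace IsRadialMollifier

lemma fderiv_mollify (h : IsRadialMollifier ρ b) {F : En n → ℝ}
    (hF : LocallyIntegrable F volume) (x : En n) :
    DifferentiableAt ℝ (mollify ρ F) x ∧ ∀ v,
      fderiv ℝ (mollify ρ F) x v = -∫ y, F y * (b (x - y) * ⟪x - y, v⟫) := by
  have hd := h.hasCompactSupport.hasFDerivAt_convolution_right (ContinuousLinearMap.mul ℝ ℝ)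
    hF (h.smooth.of_le (by norm_num)) x
  refine ⟨hd.differentiableAt, fun v => ?_⟩
  rw [mollify_eq_convolution, hd.fderiv, convolution]
  have hc : Continuous (fderiv ℝ ρ) := h.smooth.continuous_fderiv (by norm_num)
  have hintg : ConvolutionExists F (fderiv ℝ ρ)
      ((ContinuousLinearMap.mul ℝ ℝ).precompR (En n)) volume :=
    (h.hasCompactSupport.fderiv ℝ).convolutionExists_right _ hF hc
  rw [ContinuousLinearMap.integral_apply (hintg x), ← integral_neg]
  congr 1 with y
  simp [ContinuousLinearMap.precompR_apply, h.fderiv_apply]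

lemma contDiff_mollify (h : IsRadialMollifier ρ b) {F : En n → ℝ}
    (hF : LocallyIntegrable F volume) : ContDiff ℝ 2 (mollify ρ F) :=
  h.hasCompactSupport.contDiff_convolution_right (n := 2) (ContinuousLinearMap.mul ℝ ℝ) hF h.smooth

end IsRadialMollifier

namespace IsSemiconcaveWith

variable {U : En n → ℝ} {P : En n → En n} {C L : ℝ}

lemma aestronglyMeasurable (hs : IsSemiconcaveWith U P C L) :
    AEStronglyMeasurable P volume := by
  refine AEStronglyMeasurable.congr
    (f := fun x => (InnerProductSpace.toDual ℝ (En n)).symm (fderiv ℝ U x)) ?_ ?_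
  · exact ((InnerProductSpace.toDual ℝ (En n)).symm.continuous.measurable.comp
      (measurable_fderiv ℝ U)).aestronglyMeasurable
  · filter_upwards [hs.ae_differentiableAt volume] with x hx
    rw [(hs.hasFDerivAt_of_differentiableAt hx).fderiv, LinearIsometryEquiv.symm_apply_eq]
    ext v; simp

lemma continuous (hs : IsSemiconcaveWith U P C L) : Continuous U := hs.lipschitzWith.continuous

lemma aestronglyMeasurable_inner (hs : IsSemiconcaveWith U P C L) (v : En n) :
    AEStronglyMeasurable (fun y => ⟪P y, v⟫) volume :=
  hs.aestronglyMeasurable.inner aestronglyMeasurable_const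

lemma abs_inner_le (hs : IsSemiconcaveWith U P C L) (v y : En n) :
    |⟪P y, v⟫| ≤ L * ‖v‖ :=
  (abs_real_inner_le_norm _ _).trans (by gcongr; exact hs.bound y)

lemma locallyIntegrable_inner (hs : IsSemiconcaveWith U P C L) (v : En n) :
    LocallyIntegrable (fun y => ⟪P y, v⟫) volume :=
  (locallyIntegrable_const (L * ‖v‖)).mono (hs.aestronglyMeasurable_inner v)
    (Eventually.of_forall fun y =>
      (hs.abs_inner_le v y).trans (le_abs_self _))

lemma abs_mollify_sub_le (h : IsRadialMollifier ρ b) (hs : IsSemiconcaveWith U P C L) (x : En n) :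
    |mollify ρ U x - U x| ≤ L := by
  have hL := hs.bound_nonneg
  have h1 : Integrable fun y => U y * ρ (x - y) := by
    refine (hs.continuous.mul (h.smooth.continuous.comp
      (continuous_const.sub continuous_id))).integrable_of_hasCompactSupport ?_
    refine HasCompactSupport.mul_left ?_
    refine HasCompactSupport.intro (isCompact_closedBall x 1) fun y hy => h.eq_zero _ ?_
    rw [mem_closedBall, dist_eq_norm, not_le, norm_sub_rev] at hy
    exact hy.le
  have h2 : mollify ρ U x - U x = ∫ y, (U y - U x) * ρ (x - y) := by
    simp_rw [sub_mul]
    rw [integral_sub h1 ((h.integrable_sub x).const_mul _), integral_const_mul, h.integral_sub,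
      mul_one, mollify]
  rw [h2, ← Real.norm_eq_abs]
  refine (norm_integral_le_of_norm_le ((h.integrable_sub x).const_mul L)
    (Eventually.of_forall fun y => ?_)).trans
    (by rw [integral_const_mul, h.integral_sub, mul_one])
  rw [norm_mul, Real.norm_eq_abs, Real.norm_of_nonneg (h.nonneg _)]
  rcases le_or_gt 1 ‖x - y‖ with h3 | h3
  · simp [h.eq_zero _ h3]
  · have := hs.abs_sub_le x y
    rw [norm_sub_rev] at this
    gcongr
    · exact h.nonneg _
    · nlinarith

/-- The limit of integrals of difference quotients against the mollifier. -/
lemma tendsto_mollify_slope {F : En n → ℝ} {x : En n}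
    (hd : DifferentiableAt ℝ (mollify ρ F) x) (hi : ∀ v, Integrable fun y => F (y + v) * ρ (x - y))
    (v : En n) :
    Tendsto (fun k : ℕ => ∫ y, (((k : ℝ) + 1) * (F (y + (1 / ((k : ℝ) + 1)) • v) - F y)) * ρ (x - y))
      atTop (𝓝 (fderiv ℝ (mollify ρ F) x v)) := by
  have h1 := hd.hasFDerivAt.hasLineDerivAt v
  have h2 : Tendsto (fun k : ℕ => 1 / ((k : ℝ) + 1)) atTop (𝓝[≠] (0 : ℝ)) := by
    refine tendsto_nhdsWithin_iff.2 ⟨tendsto_one_div_add_atTop_nhds_zero_nat, ?_⟩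
    exact Eventually.of_forall fun k => by
      have : (0 : ℝ) < 1 / ((k : ℝ) + 1) := Nat.one_div_pos_of_nat
      exact this.ne'
  refine ((hasLineDerivAt_iff_tendsto_slope_zero.1 h1).comp h2).congr fun k => ?_
  have h3 : Integrable fun y => F y * ρ (x - y) := by simpa using hi 0
  simp only [Function.comp]
  rw [mollify_add, mollify, ← integral_sub (hi _) h3, smul_eq_mul, one_div, inv_inv,
    ← integral_const_mul]
  congr 1 with y
  ring

lemma fderiv_mollify_apply (h : IsRadialMollifier ρ b) (hs : IsSemiconcaveWith U P C L)
    (x v : En n) : fderiv ℝ (mollify ρ U) x v = mollify ρ (fun y => ⟪P y, v⟫) x := by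
  have hi : ∀ v, Integrable fun y => U (y + v) * ρ (x - y) := by
    intro v
    refine ((hs.continuous.comp (continuous_id.add continuous_const)).mul (h.smooth.continuous.comp
      (continuous_const.sub continuous_id))).integrable_of_hasCompactSupport ?_
    refine HasCompactSupport.mul_left ?_
    refine HasCompactSupport.intro (isCompact_closedBall x 1) fun y hy => h.eq_zero _ ?_
    rw [mem_closedBall, dist_eq_norm, not_le, norm_sub_rev] at hy
    exact hy.le
  refine tendsto_nhds_unique (tendsto_mollify_slope
    (h.fderiv_mollify hs.continuous.locallyIntegrable x).1 hi v) ?_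
  refine tendsto_integral_of_dominated_convergence (fun y => L * ‖v‖ * ρ (x - y)) (fun k => ?_)
    ((h.integrable_sub x).const_mul _) (fun k => Eventually.of_forall fun y => ?_) ?_
  · exact (((continuous_const.mul ((hs.continuous.comp (continuous_id.add continuous_const)).sub
      hs.continuous)).mul (h.smooth.continuous.comp
      (continuous_const.sub continuous_id)))).aestronglyMeasurable
  · rw [norm_mul, Real.norm_of_nonneg (h.nonneg _)]
    gcongr
    · exact h.nonneg _
    · rw [norm_mul, Real.norm_eq_abs, Real.norm_eq_abs]
      have := hs.abs_sub_le y (y + (1 / ((k : ℝ) + 1)) • v)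
      have hk : (0 : ℝ) < (k : ℝ) + 1 := by positivity
      rw [add_sub_cancel_left, norm_smul, Real.norm_of_nonneg (by positivity)] at this
      rw [abs_of_pos hk]
      calc ((k : ℝ) + 1) * _ ≤ ((k : ℝ) + 1) * (L * (1 / ((k : ℝ) + 1) * ‖v‖)) := by gcongr
        _ = L * ‖v‖ := by field_simp
  · filter_upwards [hs.ae_differentiableAt volume] with y hy
    refine Tendsto.mul_const _ ?_
    have h1 := (hs.hasFDerivAt_of_differentiableAt hy).hasLineDerivAt v
    have h2 : Tendsto (fun k : ℕ => 1 / ((k : ℝ) + 1)) atTop (𝓝[≠] (0 : ℝ)) := by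
      refine tendsto_nhdsWithin_iff.2 ⟨tendsto_one_div_add_atTop_nhds_zero_nat, ?_⟩
      exact Eventually.of_forall fun k => by
        have : (0 : ℝ) < 1 / ((k : ℝ) + 1) := Nat.one_div_pos_of_nat
        exact this.ne'
    refine ((hasLineDerivAt_iff_tendsto_slope_zero.1 h1).comp h2).congr fun k => ?_
    simp only [Function.comp, one_div, inv_inv, smul_eq_mul]

lemma secondDeriv_mollify (h : IsRadialMollifier ρ b) (hs : IsSemiconcaveWith U P C L)
    (x v w : En n) :
    secondDeriv n (mollify ρ U) x w v = fderiv ℝ (mollify ρ (fun y => ⟪P y, v⟫)) x w := by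
  have h1 : (mollify ρ (fun y => ⟪P y, v⟫)) = fun x => fderiv ℝ (mollify ρ U) x v := by
    ext x; rw [hs.fderiv_mollify_apply h]
  have h2 : DifferentiableAt ℝ (fderiv ℝ (mollify ρ U)) x :=
    ((h.contDiff_mollify hs.continuous.locallyIntegrable).fderiv_right (m := 1)
      (by norm_num)).differentiable (by norm_num) x
  rw [h1, secondDeriv, fderiv_clm_apply h2 (differentiableAt_const v)]
  simp

lemma laplacian_mollify (h : IsRadialMollifier ρ b) (hs : IsSemiconcaveWith U P C L) (x : En n) :
    laplacian n (mollify ρ U) x = -∫ y, b (x - y) * ⟪x - y, P y⟫ := by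
  rw [laplacian]
  simp_rw [hs.secondDeriv_mollify h, (h.fderiv_mollify (hs.locallyIntegrable_inner _) x).2]
  rw [Finset.sum_neg_distrib, ← integral_finsetSum]
  · congr 2 with y
    have := (EuclideanSpace.basisFun (Fin n) ℝ).sum_inner_mul_inner (x - y) (P y)
    rw [← this, Finset.mul_sum]
    refine Finset.sum_congr rfl fun i _ => ?_
    rw [real_inner_comm (P y)]
    ring
  · intro i _
    have hb : Continuous fun y => b (x - y) * ⟪x - y, EuclideanSpace.basisFun (Fin n) ℝ i⟫ :=
      (h.b_continuous.comp (continuous_const.sub continuous_id)).mul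
        ((continuous_const.sub continuous_id).inner continuous_const)
    have hbi : Integrable fun y => b (x - y) * ⟪x - y, EuclideanSpace.basisFun (Fin n) ℝ i⟫ := by
      refine hb.integrable_of_hasCompactSupport (HasCompactSupport.mul_right ?_)
      refine HasCompactSupport.intro (isCompact_closedBall x 1) fun y hy => h.b_eq_zero _ ?_
      rw [mem_closedBall, dist_eq_norm, not_le, norm_sub_rev] at hy
      exact hy.le
    exact hbi.bdd_mul (c := L * ‖EuclideanSpace.basisFun (Fin n) ℝ i‖)
      (hs.aestronglyMeasurable_inner _) (Eventually.of_forall fun y => hs.abs_inner_le _ y)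

end IsSemiconcaveWith

end Mollification

section PForm

variable {n : ℕ} {ρ b : En n → ℝ}

/-- The quadratic form `(p - 2) ⟨A v, v⟩ + tr A`. -/
def pForm (p : ℝ) (A : En n →L[ℝ] En n) (v : En n) : ℝ :=
  (p - 2) * ⟪A v, v⟫ + ∑ i : Fin n,
    ⟪A (EuclideanSpace.basisFun (Fin n) ℝ i), EuclideanSpace.basisFun (Fin n) ℝ i⟫

/-- If `⟪A w, w⟫ ≤ K ‖w‖²` then `pForm p A` is at most `(p - 2 + n) K` on the unit ball. -/
lemma pForm_le_of_inner_le {n : ℕ} {p K : ℝ} (hp : 2 ≤ p) (hK : 0 ≤ K) {A : En n →L[ℝ] En n}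
    (h : ∀ w, ⟪A w, w⟫ ≤ K * ‖w‖ ^ 2) {v : En n} (hv : ‖v‖ ≤ 1) :
    pForm p A v ≤ (p - 2 + n) * K := by
  have h2 : ∑ i : Fin n, ⟪A (EuclideanSpace.basisFun (Fin n) ℝ i),
      EuclideanSpace.basisFun (Fin n) ℝ i⟫ ≤ ∑ _i : Fin n, K :=
    Finset.sum_le_sum fun i _ => (h _).trans (by simp)
  rw [Finset.sum_const, Finset.card_univ, Fintype.card_fin, nsmul_eq_mul] at h2
  have h3 : K * ‖v‖ ^ 2 ≤ K := by nlinarith [norm_nonneg v, mul_nonneg hK (norm_nonneg v)]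
  have h4 : (p - 2) * ⟪A v, v⟫ ≤ (p - 2) * K :=
    mul_le_mul_of_nonneg_left ((h v).trans h3) (by linarith)
  unfold pForm
  linarith

/-- The second-order operator `(p - 2) D²w(v, v) + Δw` at `x`. -/
def pSecond (p : ℝ) (w : En n → ℝ) (x v : En n) : ℝ :=
  (p - 2) * secondDeriv n w x v v + laplacian n w x

namespace IsSemiconcaveWith

variable {U : En n → ℝ} {P : En n → En n} {C L : ℝ}

lemma slope_le (hs : IsSemiconcaveWith U P C L) (y v : En n) (k : ℕ) :
    ((k : ℝ) + 1) * (⟪P (y + (1 / ((k : ℝ) + 1)) • v), v⟫ - ⟪P y, v⟫) ≤ C * ‖v‖ ^ 2 := by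
  have h1 := hs.inner_sub_le y (y + (1 / ((k : ℝ) + 1)) • v)
  have hk : (0 : ℝ) < (k : ℝ) + 1 := by positivity
  rw [add_sub_cancel_left, inner_smul_right, norm_smul, Real.norm_of_nonneg (by positivity),
    inner_sub_left] at h1
  rw [← sub_nonneg] at h1 ⊢
  have : C * ‖v‖ ^ 2 - ((k : ℝ) + 1) * (⟪P (y + (1 / ((k : ℝ) + 1)) • v), v⟫ - ⟪P y, v⟫)
      = ((k : ℝ) + 1) ^ 2 * (C * (1 / ((k : ℝ) + 1) * ‖v‖) ^ 2 - 1 / ((k : ℝ) + 1)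
        * (⟪P (y + (1 / ((k : ℝ) + 1)) • v), v⟫ - ⟪P y, v⟫)) := by
    field_simp
  rw [this]
  positivity

lemma aestronglyMeasurable_slope (hs : IsSemiconcaveWith U P C L) (v : En n) (k : ℕ) :
    AEStronglyMeasurable
      (fun y => ((k : ℝ) + 1) * (⟪P (y + (1 / ((k : ℝ) + 1)) • v), v⟫ - ⟪P y, v⟫)) volume :=
  (((hs.aestronglyMeasurable_inner v).comp_quasiMeasurePreserving
    (measurePreserving_add_right volume _).quasiMeasurePreserving).sub
    (hs.aestronglyMeasurable_inner v)).const_mul _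

lemma tendsto_slope {A : En n →L[ℝ] En n} {y : En n} (hA : HasFDerivAt P A y) (v : En n) :
    Tendsto (fun k : ℕ => ((k : ℝ) + 1) * (⟪P (y + (1 / ((k : ℝ) + 1)) • v), v⟫ - ⟪P y, v⟫))
      atTop (𝓝 ⟪A v, v⟫) := by
  have h2 : Tendsto (fun k : ℕ => 1 / ((k : ℝ) + 1)) atTop (𝓝[≠] (0 : ℝ)) := by
    refine tendsto_nhdsWithin_iff.2 ⟨tendsto_one_div_add_atTop_nhds_zero_nat, ?_⟩
    exact Eventually.of_forall fun k => by
      have : (0 : ℝ) < 1 / ((k : ℝ) + 1) := Nat.one_div_pos_of_nat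
      exact this.ne'
  have h3 := (hasLineDerivAt_iff_tendsto_slope_zero.1 (hA.hasLineDerivAt v)).comp h2
  refine (h3.inner tendsto_const_nhds).congr fun k => ?_
  simp only [Function.comp, one_div, inv_inv]
  rw [real_inner_smul_left, inner_sub_left]

lemma integrable_slope (h : IsRadialMollifier ρ b) (hs : IsSemiconcaveWith U P C L)
    (x v : En n) (k : ℕ) :
    Integrable fun y =>
      (((k : ℝ) + 1) * (⟪P (y + (1 / ((k : ℝ) + 1)) • v), v⟫ - ⟪P y, v⟫)) * ρ (x - y) := by
  refine (h.integrable_sub x).bdd_mul (c := ((k : ℝ) + 1) * (L * ‖v‖ + L * ‖v‖))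
    (hs.aestronglyMeasurable_slope v k) (Eventually.of_forall fun y => ?_)
  rw [norm_mul, Real.norm_of_nonneg (by positivity : (0 : ℝ) ≤ (k : ℝ) + 1)]
  gcongr
  exact (norm_sub_le _ _).trans (add_le_add (hs.abs_inner_le _ _) (hs.abs_inner_le _ _))

lemma tendsto_secondDeriv (h : IsRadialMollifier ρ b) (hs : IsSemiconcaveWith U P C L)
    (x v : En n) :
    Tendsto (fun k : ℕ => ∫ y,
      (((k : ℝ) + 1) * (⟪P (y + (1 / ((k : ℝ) + 1)) • v), v⟫ - ⟪P y, v⟫)) * ρ (x - y))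
      atTop (𝓝 (secondDeriv n (mollify ρ U) x v v)) := by
  rw [hs.secondDeriv_mollify h]
  refine tendsto_mollify_slope (F := fun y => ⟪P y, v⟫)
    (h.fderiv_mollify (hs.locallyIntegrable_inner v) x).1 (fun v' => ?_) v
  exact (h.integrable_sub x).bdd_mul (c := L * ‖v‖)
    ((hs.aestronglyMeasurable_inner v).comp_quasiMeasurePreserving
    (measurePreserving_add_right volume _).quasiMeasurePreserving)
    (Eventually.of_forall fun y => hs.abs_inner_le _ _)

lemma secondDeriv_mollify_le (h : IsRadialMollifier ρ b) (hs : IsSemiconcaveWith U P C L)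
    (x v : En n) : secondDeriv n (mollify ρ U) x v v ≤ C * ‖v‖ ^ 2 := by
  refine le_of_tendsto' (hs.tendsto_secondDeriv h x v) fun k => ?_
  calc _ ≤ ∫ y, (C * ‖v‖ ^ 2) * ρ (x - y) := by
        refine integral_mono (hs.integrable_slope h x v k) ((h.integrable_sub x).const_mul _)
          fun y => ?_
        exact mul_le_mul_of_nonneg_right (hs.slope_le y v k) (h.nonneg _)
    _ = C * ‖v‖ ^ 2 := by rw [integral_const_mul, h.integral_sub, mul_one]

/-- Mollification does not increase `(p - 2) D²w(v, v) + Δw` on average: only the absolutely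
continuous part of the Hessian matters for an upper bound. -/
lemma pSecond_mollify_le_integral (h : IsRadialMollifier ρ b) (hs : IsSemiconcaveWith U P C L)
    {p : ℝ} (hp : 2 ≤ p) {x v : En n} {Φ : En n → ℝ} {K : ℝ} (hΦ : Measurable Φ)
    (hK : ∀ y, |Φ y| ≤ K)
    (hle : ∀ᵐ y, ‖x - y‖ < 1 → pForm p (fderiv ℝ P y) v ≤ Φ y) :
    pSecond p (mollify ρ U) x v ≤ ∫ y, Φ y * ρ (x - y) := by
  set e : Fin n → En n := fun i => EuclideanSpace.basisFun (Fin n) ℝ i with he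
  set s : ℕ → En n → En n → ℝ := fun k v y =>
    ((k : ℝ) + 1) * (⟪P (y + (1 / ((k : ℝ) + 1)) • v), v⟫ - ⟪P y, v⟫) with hsdef
  set q : ℕ → En n → ℝ := fun k y => (p - 2) * s k v y + ∑ i, s k (e i) y with hq
  have hqm : ∀ k, AEStronglyMeasurable (q k) volume := fun k =>
    ((hs.aestronglyMeasurable_slope v k).const_mul _).add
      (Finset.aestronglyMeasurable_fun_sum _ fun i _ => hs.aestronglyMeasurable_slope (e i) k)
  have hqi : ∀ k, Integrable fun y => q k y * ρ (x - y) := by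
    intro k
    simp only [hq, add_mul, Finset.sum_mul, mul_assoc]
    refine Integrable.add ?_ (integrable_finsetSum _ fun i _ => ?_)
    · have := (hs.integrable_slope h x v k).const_mul (p - 2)
      exact this
    · have := (hs.integrable_slope h x (e i) k)
      exact this
  have hql : Tendsto (fun k => ∫ y, q k y * ρ (x - y)) atTop
      (𝓝 (pSecond p (mollify ρ U) x v)) := by
    have hst : ∀ v, Tendsto (fun k => ∫ y, s k v y * ρ (x - y)) atTop
        (𝓝 (secondDeriv n (mollify ρ U) x v v)) := fun v => hs.tendsto_secondDeriv h x v
    have hsi : ∀ k v, Integrable fun y => s k v y * ρ (x - y) := fun k v =>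
      hs.integrable_slope h x v k
    clear_value s
    refine (((hst v).const_mul (p - 2)).add
      (tendsto_finsetSum Finset.univ fun i _ => hst (e i))).congr fun k => ?_
    simp only [hq, add_mul, Finset.sum_mul, mul_assoc]
    rw [integral_add ((hsi k v).const_mul _) (integrable_finsetSum _ fun i _ => hsi k (e i)),
      integral_finsetSum _ fun i _ => hsi k (e i), integral_const_mul]
  set B : ℝ := (p - 2) * (C * ‖v‖ ^ 2) + ∑ i, C * ‖e i‖ ^ 2 with hB
  have hqB : ∀ k y, q k y ≤ B := fun k y =>
    add_le_add (mul_le_mul_of_nonneg_left (hs.slope_le y v k) (by linarith))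
      (Finset.sum_le_sum fun i _ => hs.slope_le y (e i) k)
  have hΦi : Integrable fun y => Φ y * ρ (x - y) :=
    (h.integrable_sub x).bdd_mul hΦ.aestronglyMeasurable (Eventually.of_forall hK)
  have hmb : ∀ k y, |max (q k y - Φ y) 0| ≤ |B| + K := by
    intro k y
    have h2 := abs_le.1 (hK y)
    rw [abs_of_nonneg (le_max_right _ _)]
    refine max_le ?_ (by linarith [abs_nonneg B])
    linarith [hqB k y, le_abs_self B]
  have hmm : ∀ k, AEStronglyMeasurable (fun y => max (q k y - Φ y) 0) volume := fun k =>
    ((hqm k).sub hΦ.aestronglyMeasurable).sup aestronglyMeasurable_const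
  have hmi : ∀ k, Integrable fun y => max (q k y - Φ y) 0 * ρ (x - y) := fun k =>
    (h.integrable_sub x).bdd_mul (hmm k) (Eventually.of_forall (hmb k))
  have hlim : Tendsto (fun k => ∫ y, max (q k y - Φ y) 0 * ρ (x - y)) atTop
      (𝓝 (∫ _y : En n, (0 : ℝ))) := by
    refine tendsto_integral_of_dominated_convergence (fun y => (|B| + K) * ρ (x - y))
      (fun k => (hmi k).aestronglyMeasurable) ((h.integrable_sub x).const_mul _)
      (fun k => Eventually.of_forall fun y => ?_) ?_
    · rw [norm_mul, Real.norm_of_nonneg (h.nonneg _)]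
      exact mul_le_mul_of_nonneg_right (hmb k y) (h.nonneg _)
    · filter_upwards [hle, hs.ae_differentiableAt_gradient volume] with y hy hd
      rcases lt_or_ge ‖x - y‖ 1 with h1 | h1
      · have h2 : Tendsto (fun k => q k y) atTop (𝓝 (pForm p (fderiv ℝ P y) v)) :=
          ((tendsto_slope hd.hasFDerivAt v).const_mul _).add
            (tendsto_finsetSum _ fun i _ => tendsto_slope hd.hasFDerivAt (e i))
        have h3 := ((h2.sub_const (Φ y)).max (tendsto_const_nhds (x := (0 : ℝ)))).mul_const
          (ρ (x - y))
        rwa [max_eq_right (sub_nonpos.2 (hy h1)), zero_mul] at h3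
      · simp [h.eq_zero _ h1]
  rw [integral_zero] at hlim
  have hsum := hlim.const_add (∫ y, Φ y * ρ (x - y))
  rw [add_zero] at hsum
  refine le_of_tendsto_of_tendsto' hql hsum fun k => ?_
  rw [← integral_add hΦi (hmi k)]
  refine integral_mono (hqi k) (hΦi.add (hmi k)) fun y => ?_
  simp only [← add_mul]
  refine mul_le_mul_of_nonneg_right ?_ (h.nonneg _)
  linarith [le_max_left (q k y - Φ y) 0]

end IsSemiconcaveWith

end PForm

section Core

variable {n : ℕ} {ρ b : En n → ℝ}

lemma real_inner_gradient {w : En n → ℝ} {x : En n} (v : En n) :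
    ⟪gradient w x, v⟫ = fderiv ℝ w x v := by
  rw [gradient, InnerProductSpace.toDual_symm_apply]

/-- The function equal to `a` on `ball x r` and to `c` elsewhere. -/
def coreShell (x : En n) (r a c : ℝ) (y : En n) : ℝ :=
  a + (ball x r)ᶜ.indicator (fun _ => c - a) y

lemma coreShell_of_mem {x y : En n} {r a c : ℝ} (hy : y ∈ ball x r) :
    coreShell x r a c y = a := by
  simp [coreShell, indicator_of_notMem (s := (ball x r)ᶜ) (a := y) (not_not.2 hy)]

lemma coreShell_of_notMem {x y : En n} {r a c : ℝ} (hy : y ∉ ball x r) :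
    coreShell x r a c y = c := by
  rw [coreShell, indicator_of_mem (s := (ball x r)ᶜ) (a := y) hy]; ring

lemma measurable_coreShell (x : En n) (r a c : ℝ) : Measurable (coreShell x r a c) :=
  measurable_const.add (measurable_const.indicator measurableSet_ball.compl)

lemma abs_coreShell_le (x y : En n) (r a c : ℝ) :
    |coreShell x r a c y| ≤ max |a| |c| := by
  by_cases hy : y ∈ ball x r
  · rw [coreShell_of_mem hy]; exact le_max_left _ _
  · rw [coreShell_of_notMem hy]; exact le_max_right _ _

namespace IsRadialMollifier

lemma integral_coreShell_le (h : IsRadialMollifier ρ b) {r τ a c : ℝ}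
    {x : En n} (hr : ∫ y, (ball x r)ᶜ.indicator (fun y => ρ (x - y)) y ≤ τ) (hac : a ≤ c) :
    ∫ y, coreShell x r a c y * ρ (x - y) ≤ a + τ * (c - a) := by
  have h1 : ∀ y, coreShell x r a c y * ρ (x - y)
      = a * ρ (x - y) + (c - a) * (ball x r)ᶜ.indicator (fun y => ρ (x - y)) y := by
    intro y
    by_cases hy : y ∈ (ball x r)ᶜ
    · rw [coreShell, indicator_of_mem hy, indicator_of_mem hy]; ring
    · rw [coreShell, indicator_of_notMem hy, indicator_of_notMem hy]; ring
  simp_rw [h1]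
  rw [integral_add ((h.integrable_sub x).const_mul _)
    (((h.integrable_sub x).indicator measurableSet_ball.compl).const_mul _), integral_const_mul,
    integral_const_mul, h.integral_sub, mul_one]
  nlinarith

end IsRadialMollifier

namespace IsSemiconcaveWith

variable {U : En n → ℝ} {P : En n → En n} {C L : ℝ}

lemma inner_fderiv_le (hs : IsSemiconcaveWith U P C L) {A : En n →L[ℝ] En n} {y : En n}
    (hA : HasFDerivAt P A y) (v : En n) : ⟪A v, v⟫ ≤ C * ‖v‖ ^ 2 :=
  le_of_tendsto' (tendsto_slope hA v) fun k => hs.slope_le y v k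

lemma pForm_le (hs : IsSemiconcaveWith U P C L) (hC : 0 ≤ C) {p : ℝ} (hp : 2 ≤ p)
    {A : En n →L[ℝ] En n} {y : En n}
    (hA : HasFDerivAt P A y) {v : En n} (hv : ‖v‖ ≤ 1) : pForm p A v ≤ (p - 2 + n) * C :=
  pForm_le_of_inner_le hp hC (hs.inner_fderiv_le hA) hv

lemma pSecond_mollify_le (h : IsRadialMollifier ρ b) (hs : IsSemiconcaveWith U P C L)
    (hC : 0 ≤ C) {p : ℝ} (hp : 2 ≤ p) {x v : En n} (hv : ‖v‖ ≤ 1) {r τ a : ℝ}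
    (hτ : ∫ y, (ball x r)ᶜ.indicator (fun y => ρ (x - y)) y ≤ τ) (ha : a ≤ (p - 2 + n) * C)
    (hle : ∀ y ∈ ball x r, ∀ A, HasFDerivAt P A y → pForm p A v ≤ a) :
    pSecond p (mollify ρ U) x v ≤ a + τ * ((p - 2 + n) * C - a) := by
  refine (hs.pSecond_mollify_le_integral h hp (measurable_coreShell x r a ((p - 2 + n) * C))
    (fun y => abs_coreShell_le x y r _ _) ?_).trans (h.integral_coreShell_le hτ ha)
  filter_upwards [hs.ae_differentiableAt_gradient volume] with y hd _
  by_cases hy : y ∈ ball x r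
  · rw [coreShell_of_mem hy]; exact hle y hy _ hd.hasFDerivAt
  · rw [coreShell_of_notMem hy]; exact hs.pForm_le hC hp hd.hasFDerivAt hv

lemma norm_gradient_mollify_sub_le (h : IsRadialMollifier ρ b) (hs : IsSemiconcaveWith U P C L)
    {x : En n} {r τ κ : ℝ} (hτ : ∫ y, (ball x r)ᶜ.indicator (fun y => ρ (x - y)) y ≤ τ)
    (hκ : 0 ≤ κ) (hP : ∀ y ∈ ball x r, ‖P y - P x‖ ≤ κ) :
    ‖gradient (mollify ρ U) x - P x‖ ≤ κ + 2 * L * τ := by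
  have hL := hs.bound_nonneg
  have hτ0 : 0 ≤ τ := le_trans (integral_nonneg fun y =>
    indicator_nonneg (fun z _ => h.nonneg _) y) hτ
  set D := gradient (mollify ρ U) x - P x with hD
  have h1 : ⟪D, D⟫ = ∫ y, (⟪P y, D⟫ - ⟪P x, D⟫) * ρ (x - y) := by
    have h2 : Integrable fun y => ⟪P y, D⟫ * ρ (x - y) :=
      (h.integrable_sub x).bdd_mul (hs.aestronglyMeasurable_inner D)
        (Eventually.of_forall fun y => hs.abs_inner_le D y)
    simp_rw [sub_mul]
    rw [integral_sub h2 ((h.integrable_sub x).const_mul _), integral_const_mul, h.integral_sub,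
      mul_one]
    conv_lhs => rw [hD, inner_sub_left, real_inner_gradient, ← hD, hs.fderiv_mollify_apply h]
    rfl
  have h3 : ⟪D, D⟫ ≤ ‖D‖ * (κ + 2 * L * τ) := by
    have hcs : ∫ y, coreShell x r (κ * ‖D‖) ((κ + 2 * L) * ‖D‖) y * ρ (x - y)
        ≤ κ * ‖D‖ + τ * ((κ + 2 * L) * ‖D‖ - κ * ‖D‖) :=
      h.integral_coreShell_le hτ (by gcongr; linarith)
    rw [h1]
    refine le_trans (integral_mono ?_ ?_ fun y => ?_) (hcs.trans (le_of_eq (by ring)))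
    · exact (h.integrable_sub x).bdd_mul (c := 2 * L * ‖D‖)
        ((hs.aestronglyMeasurable_inner D).sub aestronglyMeasurable_const)
        (Eventually.of_forall fun y => (norm_sub_le _ _).trans
          ((add_le_add (hs.abs_inner_le D y) (hs.abs_inner_le D x)).trans (le_of_eq (by ring))))
    · exact (h.integrable_sub x).bdd_mul (measurable_coreShell _ _ _ _).aestronglyMeasurable
        (Eventually.of_forall fun y => abs_coreShell_le x y r _ _)
    · refine mul_le_mul_of_nonneg_right ?_ (h.nonneg _)
      rw [← inner_sub_left]
      refine (real_inner_le_norm _ _).trans ?_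
      by_cases hy : y ∈ ball x r
      · rw [coreShell_of_mem hy]
        gcongr
        exact hP y hy
      · rw [coreShell_of_notMem hy]
        gcongr
        linarith [norm_sub_le (P y) (P x), hs.bound y, hs.bound x]
  rw [real_inner_self_eq_norm_sq] at h3
  rcases (norm_nonneg D).eq_or_lt with h4 | h4
  · rw [← h4]; positivity
  · nlinarith

end IsSemiconcaveWith

end Core

section Oscillation

variable {n : ℕ} {ρ b : En n → ℝ}

/-- A lower bound on the Laplacian of the mollification controls the oscillation of the
supergradients on smaller balls. -/
lemma IsRadialMollifier.exists_oscillation_bound (h : IsRadialMollifier ρ b) {r : ℝ}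
    (hr0 : 0 < r) (hr : r < 1) :
    ∃ K, 0 ≤ K ∧ ∀ (U : En n → ℝ) (P : En n → En n) (C L M : ℝ), IsSemiconcaveWith U P C L →
      0 ≤ C → 0 ≤ M → ∀ x, -M ≤ laplacian n (mollify ρ U) x →
      ∀ v, ‖v‖ ≤ r → ‖P (x + v) - P x‖ ≤ K * (C + M) := by
  set r' : ℝ := (1 - r) / 6 with hr'
  have hr'0 : 0 < r' := by rw [hr']; linarith
  obtain ⟨b0, hb0, hb⟩ : ∃ b0, 0 < b0 ∧ ∀ z : En n, ‖z‖ ≤ (1 + r) / 2 → b0 ≤ b z := by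
    obtain ⟨z0, hz0, hmin⟩ := (isCompact_closedBall (0 : En n) ((1 + r) / 2)).exists_isMinOn
      ⟨0, by simp; linarith⟩ h.b_continuous.continuousOn
    refine ⟨b z0, h.b_pos _ ?_, fun z hz => hmin (by simpa using hz)⟩
    have : ‖z0‖ ≤ (1 + r) / 2 := by simpa using hz0
    linarith
  set V : ℝ := volume.real (ball (0 : En n) r') with hV
  have hV0 : 0 < V := ENNReal.toReal_pos (measure_ball_pos _ _ hr'0).ne' measure_ball_lt_top.ne
  have hbi : Integrable fun z : En n => b z * ‖z‖ ^ 2 :=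
    (h.b_continuous.mul (continuous_norm.pow 2)).integrable_of_hasCompactSupport
      h.hasCompactSupport_b.mul_right
  set B2 : ℝ := ∫ z : En n, b z * ‖z‖ ^ 2 with hB2
  have hB20 : 0 ≤ B2 := integral_nonneg fun z => mul_nonneg (h.b_nonneg z) (by positivity)
  set K : ℝ := (b0 * (r' * V))⁻¹ with hK
  have hK0 : 0 ≤ K := by positivity
  refine ⟨1 + K * B2 + K, by positivity, ?_⟩
  intro U P C L M hs hC hM x hx v hv
  have hL := hs.bound_nonneg
  set G : En n → ℝ := fun v => C / 2 * ‖v‖ ^ 2 - (U (x + v) - U x - ⟪P x, v⟫) with hG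
  set Q : En n → En n := fun v => C • v - P (x + v) + P x with hQ
  have hsub : ∀ v v', G v + ⟪Q v, v' - v⟫ ≤ G v' := by
    intro v v'
    have h1 := hs.upper (x + v) (x + v')
    rw [add_sub_add_left_eq_sub] at h1
    have h2 : ‖v' - v‖ ^ 2 = ‖v'‖ ^ 2 - ‖v‖ ^ 2 - 2 * ⟪v, v' - v⟫ := by
      rw [norm_sub_sq_real, inner_sub_right, real_inner_self_eq_norm_sq, real_inner_comm]; ring
    simp only [hG, hQ, inner_add_left, inner_sub_left, inner_smul_left, inner_sub_right (P x)]
    rw [h2] at h1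
    simp only [RCLike.conj_to_real]
    linarith
  have hG0 : G 0 = 0 := by simp [hG]
  have hGnn : ∀ v, 0 ≤ G v := by
    intro v
    have := hsub 0 v
    simpa [hG0, hQ] using this
  have hGle : ∀ v, G v ≤ ⟪Q v, v⟫ := by
    intro v
    have := hsub v 0
    rw [hG0, zero_sub, inner_neg_right] at this
    linarith
  have hGc : Continuous G :=
    (continuous_const.mul (continuous_norm.pow 2)).sub
      (((hs.continuous.comp (continuous_const.add continuous_id)).sub continuous_const).sub
        (continuous_const.inner continuous_id))
  have hbG : Integrable fun z => b z * G z :=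
    (h.b_continuous.mul hGc).integrable_of_hasCompactSupport h.hasCompactSupport_b.mul_right
  have hPm : AEStronglyMeasurable (fun z => P (x + z)) volume :=
    hs.aestronglyMeasurable.comp_quasiMeasurePreserving
      (measurePreserving_add_left volume x).quasiMeasurePreserving
  have hbn : Integrable fun z : En n => b z * ‖z‖ :=
    (h.b_continuous.mul continuous_norm).integrable_of_hasCompactSupport
      h.hasCompactSupport_b.mul_right
  have hbP : Integrable fun z => b z * ⟪z, P (x + z)⟫ := by
    refine (hbn.const_mul L).mono' (h.b_continuous.aestronglyMeasurable.mul
      (aestronglyMeasurable_id.inner hPm)) (Eventually.of_forall fun z => ?_)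
    rw [norm_mul, Real.norm_of_nonneg (h.b_nonneg z)]
    have h1 := norm_inner_le_norm (𝕜 := ℝ) z (P (x + z))
    have h2 : ‖z‖ * ‖P (x + z)‖ ≤ ‖z‖ * L := by gcongr; exact hs.bound _
    nlinarith [h.b_nonneg z]
  have hbx : Integrable fun z => b z * ⟪z, P x⟫ :=
    (h.b_continuous.mul (continuous_id.inner continuous_const)).integrable_of_hasCompactSupport
      h.hasCompactSupport_b.mul_right
  have hlap : laplacian n (mollify ρ U) x = ∫ z, b z * ⟪z, P (x + z)⟫ := by
    rw [hs.laplacian_mollify h, ← integral_neg,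
      ← integral_add_left_eq_self (fun y => -(b (x - y) * ⟪x - y, P y⟫)) x]
    congr 1 with z
    rw [sub_add_cancel_left, h.b_neg, inner_neg_left]
    ring
  have hodd : ∫ z, b z * ⟪z, P x⟫ = 0 := by
    have h1 := integral_neg_eq_self (fun z => b z * ⟪z, P x⟫) volume
    simp only [h.b_neg, inner_neg_left, mul_neg, integral_neg] at h1
    linarith
  have hintg : ∫ z, b z * G z ≤ C * B2 + M := by
    calc ∫ z, b z * G z
        ≤ ∫ z, (C * (b z * ‖z‖ ^ 2) - b z * ⟪z, P (x + z)⟫ + b z * ⟪z, P x⟫) := by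
          refine integral_mono hbG (((hbi.const_mul C).sub hbP).add hbx) fun z => ?_
          refine (mul_le_mul_of_nonneg_left (hGle z) (h.b_nonneg z)).trans (le_of_eq ?_)
          have h1 : ⟪Q z, z⟫ = C * ‖z‖ ^ 2 - ⟪z, P (x + z)⟫ + ⟪z, P x⟫ := by
            rw [real_inner_comm]
            simp only [hQ, inner_add_right, inner_sub_right, real_inner_smul_right,
              real_inner_self_eq_norm_sq]
          rw [h1]
          ring
      _ = C * B2 - laplacian n (mollify ρ U) x := by
          have h1 : ∫ z, (C * (b z * ‖z‖ ^ 2) - b z * ⟪z, P (x + z)⟫ + b z * ⟪z, P x⟫)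
              = (∫ z, (C * (b z * ‖z‖ ^ 2) - b z * ⟪z, P (x + z)⟫)) + ∫ z, b z * ⟪z, P x⟫ :=
            integral_add ((hbi.const_mul C).sub hbP) hbx
          rw [h1, MeasureTheory.integral_sub (hbi.const_mul C) hbP,
            integral_const_mul, hodd, hlap, add_zero]
      _ ≤ _ := by linarith
  have hQle : ‖Q v‖ ≤ K * (C * B2 + M) := by
    rcases eq_or_ne (Q v) 0 with h0 | h0
    · rw [h0, norm_zero]; positivity
    have hQn : 0 < ‖Q v‖ := norm_pos_iff.2 h0
    set d : En n := ‖Q v‖⁻¹ • Q v with hd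
    have hdn : ‖d‖ = 1 := by rw [hd, norm_smul, norm_inv, norm_norm, inv_mul_cancel₀ hQn.ne']
    set c : En n := v + (2 * r') • d with hc
    have hlow : ∀ y ∈ ball c r', b0 * (r' * ‖Q v‖) ≤ b y * G y := by
      intro y hy
      rw [mem_ball, dist_eq_norm] at hy
      have h1 : ‖y‖ ≤ (1 + r) / 2 := by
        have h2 : y = (y - c) + v + (2 * r') • d := by rw [hc]; abel
        have h3 : ‖(2 * r') • d‖ = 2 * r' := by
          rw [norm_smul, hdn, Real.norm_of_nonneg (by positivity), mul_one]
        rw [h2]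
        refine (norm_add₃_le).trans ?_
        rw [h3, hr']
        rw [hr'] at hy
        linarith
      have h2 : r' * ‖Q v‖ ≤ G y := by
        refine le_trans ?_ (hsub v y)
        have h3 : y - v = (y - c) + (2 * r') • d := by rw [hc]; abel
        have h4 : ⟪Q v, (2 * r') • d⟫ = 2 * r' * ‖Q v‖ := by
          rw [hd, inner_smul_right, inner_smul_right, real_inner_self_eq_norm_sq]
          field_simp
        have h5 := abs_le.1 (abs_real_inner_le_norm (Q v) (y - c))
        rw [h3, inner_add_right, h4]
        nlinarith [hGnn v, h5.1]
      exact mul_le_mul (hb y h1) h2 (by positivity) (h.b_nonneg y)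
    have hset : V * (b0 * (r' * ‖Q v‖)) ≤ ∫ z, b z * G z := by
      calc V * (b0 * (r' * ‖Q v‖)) = ∫ _y in ball c r', b0 * (r' * ‖Q v‖) := by
            have h1 : volume.real (ball c r') = V := by
              rw [hV, Measure.real, Measure.addHaar_ball_center, Measure.real]
            rw [setIntegral_const, smul_eq_mul, h1]
        _ ≤ ∫ y in ball c r', b y * G y :=
            setIntegral_mono_on (integrableOn_const measure_ball_lt_top.ne) hbG.integrableOn
              measurableSet_ball hlow
        _ ≤ ∫ z, b z * G z := setIntegral_le_integral hbG
            (Eventually.of_forall fun z => mul_nonneg (h.b_nonneg z) (hGnn z))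
    rw [hK, inv_mul_eq_div, le_div_iff₀ (by positivity)]
    linarith [hset.trans hintg]
  have hfin : P (x + v) - P x = C • v - Q v := by simp only [hQ]; abel
  rw [hfin]
  refine (norm_sub_le _ _).trans ?_
  rw [norm_smul, Real.norm_of_nonneg hC]
  have : C * ‖v‖ ≤ C := by nlinarith
  have h1 : 0 ≤ K * C := by positivity
  have h2 : 0 ≤ K * B2 * M := by positivity
  nlinarith

end Oscillation

section Directions

variable {n : ℕ} {ρ b : En n → ℝ}

lemma inner_le_sum_mul_norm_sq {B : En n →L[ℝ] En n} (hB : ∀ v, 0 ≤ ⟪B v, v⟫) (v : En n) :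
    ⟪B v, v⟫ ≤ (∑ i : Fin n, ⟪B (EuclideanSpace.basisFun (Fin n) ℝ i),
      EuclideanSpace.basisFun (Fin n) ℝ i⟫) * ‖v‖ ^ 2 := by
  set e : Fin n → En n := fun i => EuclideanSpace.basisFun (Fin n) ℝ i with he
  have hv : v = ∑ i, v i • e i := by
    have := (EuclideanSpace.basisFun (Fin n) ℝ).sum_repr v
    simpa [he] using this.symm
  have hQ : ⟪B v, v⟫ = ∑ i, ∑ j, v i * (v j * ⟪B (e i), e j⟫) := by
    conv_lhs => rw [hv]
    simp only [map_sum, map_smul, sum_inner, inner_sum, real_inner_smul_left,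
      real_inner_smul_right]
    rw [Finset.sum_comm]
    exact Finset.sum_congr rfl fun i _ => Finset.sum_congr rfl fun j _ => by ring
  have hn : ‖v‖ ^ 2 = ∑ i, v i ^ 2 := by
    rw [EuclideanSpace.norm_sq_eq]; simp
  have h1 : 0 ≤ ∑ i, ∑ j, ⟪B (v j • e i - v i • e j), v j • e i - v i • e j⟫ :=
    Finset.sum_nonneg fun i _ => Finset.sum_nonneg fun j _ => hB _
  have h2 : ∀ i j, ⟪B (v j • e i - v i • e j), v j • e i - v i • e j⟫
      = (v j ^ 2 * ⟪B (e i), e i⟫ + v i ^ 2 * ⟪B (e j), e j⟫)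
        - (v i * (v j * ⟪B (e i), e j⟫) + v j * (v i * ⟪B (e j), e i⟫)) := by
    intro i j
    simp only [map_sub, map_smul, inner_sub_left, inner_sub_right, real_inner_smul_left,
      real_inner_smul_right]
    ring
  simp_rw [h2, Finset.sum_sub_distrib, Finset.sum_add_distrib] at h1
  rw [← hQ, Finset.sum_comm (f := fun i j => v j * (v i * ⟪B (e j), e i⟫)), ← hQ] at h1
  simp_rw [← Finset.sum_mul, ← Finset.mul_sum] at h1
  rw [← hn] at h1
  rw [← Finset.sum_mul, ← hn] at h1
  linarith

lemma sub_le_of_quadratic_comparison {t Q Q' N K m s : ℝ} (ht : 0 ≤ t) (hQ : 0 ≤ Q) (hN : 0 ≤ N)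
    (hs0 : 0 < s) (hs1 : s ≤ 1) (hQ' : Q' ≤ (1 + s) * (Q + s * N)) (hm : K - (t * Q' + N) ≤ m)
    (hps : 2 * (t + 2) * s ≤ 1) :
    K - (t * Q + N) ≤ m + 2 * (t + 2) * s * (K - m) := by
  have h1 : t * Q' ≤ t * ((1 + s) * (Q + s * N)) := mul_le_mul_of_nonneg_left hQ' ht
  have h2 : 0 ≤ t * Q + N := by positivity
  set δ := 2 * (t + 2) * s with hδ
  have hδ0 : 0 ≤ δ := by positivity
  have h3 : t * ((1 + s) * (Q + s * N)) + N ≤ (1 + δ) * (t * Q + N) := by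
    have e1 : (1 + δ) * (t * Q + N) - (t * ((1 + s) * (Q + s * N)) + N)
        = (2 * t + 3) * s * (t * Q) + s * N * (t * (1 - s) + 4) := by rw [hδ]; ring
    have : 0 ≤ 1 - s := by linarith
    have : 0 ≤ (2 * t + 3) * s * (t * Q) + s * N * (t * (1 - s) + 4) := by positivity
    linarith
  have h4 : K - m ≤ (1 + δ) * (t * Q + N) := by linarith
  have h5 : (1 - δ) * (K - m) ≤ (1 - δ) * ((1 + δ) * (t * Q + N)) :=
    mul_le_mul_of_nonneg_left h4 (by linarith)
  nlinarith [mul_nonneg (mul_nonneg hδ0 hδ0) h2]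

/-- Almost parallel directions give almost the same value of `pForm`, for matrices bounded
above. -/
lemma pForm_le_of_norm_sub_le {A : En n →L[ℝ] En n} {C p m s : ℝ} {e e' : En n} (hp : 2 ≤ p)
    (hA : ∀ v, ⟪A v, v⟫ ≤ C * ‖v‖ ^ 2) (he : ‖e‖ = 1) (he' : ‖e'‖ = 1) (hs0 : 0 < s)
    (hs1 : s ≤ 1) (hs : ‖e' - e‖ ≤ s) (hps : 2 * p * s ≤ 1) (hm : pForm p A e' ≤ m) :
    pForm p A e ≤ m + 2 * p * s * ((p - 2 + n) * C - m) := by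
  set B : En n →L[ℝ] En n := C • ContinuousLinearMap.id ℝ (En n) - A with hBdef
  have hBv : ∀ v, ⟪B v, v⟫ = C * ‖v‖ ^ 2 - ⟪A v, v⟫ := fun v => by
    simp [hBdef, inner_sub_left, real_inner_smul_left]
  have hB : ∀ v, 0 ≤ ⟪B v, v⟫ := fun v => by rw [hBv]; linarith [hA v]
  set N : ℝ := ∑ i : Fin n, ⟪B (EuclideanSpace.basisFun (Fin n) ℝ i),
      EuclideanSpace.basisFun (Fin n) ℝ i⟫ with hN
  have hN0 : 0 ≤ N := Finset.sum_nonneg fun i _ => hB _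
  have htr : ∑ i : Fin n, ⟪A (EuclideanSpace.basisFun (Fin n) ℝ i),
      EuclideanSpace.basisFun (Fin n) ℝ i⟫ = n * C - N := by
    rw [hN]
    simp [hBv]
  have hform : ∀ v : En n, ‖v‖ = 1 → pForm p A v = (p - 2 + n) * C - ((p - 2) * ⟪B v, v⟫ + N) := by
    intro v hv
    rw [pForm, htr, hBv, hv]; ring
  have hd : ⟪B (e' - e), e' - e⟫ ≤ N * s ^ 2 :=
    (inner_le_sum_mul_norm_sq hB _).trans (by gcongr)
  have hcross : s * ⟪B e', e'⟫ ≤ s * ((1 + s) * ⟪B e, e⟫) + (1 + s) * ⟪B (e' - e), e' - e⟫ := by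
    have h1 := hB (s • e - (e' - e))
    simp only [map_sub, map_smul, inner_sub_left, inner_sub_right, real_inner_smul_left,
      real_inner_smul_right] at h1 ⊢
    nlinarith
  have hQ : ⟪B e', e'⟫ ≤ (1 + s) * (⟪B e, e⟫ + s * N) := by
    have h1 : s * ⟪B e', e'⟫ ≤ s * ((1 + s) * (⟪B e, e⟫ + s * N)) := by nlinarith
    exact le_of_mul_le_mul_left h1 hs0
  rw [hform e' he'] at hm
  rw [hform e he]
  have := sub_le_of_quadratic_comparison (by linarith : 0 ≤ p - 2) (hB e) hN0 hs0 hs1 hQ hm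
    (by linarith)
  linarith

lemma norm_normalize_sub_le {a b : En n} (ha : a ≠ 0) (hb : b ≠ 0) :
    ‖‖a‖⁻¹ • a - ‖b‖⁻¹ • b‖ ≤ 2 * ‖a - b‖ / ‖a‖ := by
  have ha' : 0 < ‖a‖ := norm_pos_iff.2 ha
  have hb' : 0 < ‖b‖ := norm_pos_iff.2 hb
  have h1 : ‖a‖⁻¹ • a - ‖b‖⁻¹ • b = ‖a‖⁻¹ • ((a - b) + ((‖b‖ - ‖a‖) * ‖b‖⁻¹) • b) := by
    rw [smul_add, smul_sub, smul_smul]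
    have : ‖a‖⁻¹ * ((‖b‖ - ‖a‖) * ‖b‖⁻¹) = ‖a‖⁻¹ - ‖b‖⁻¹ := by field_simp
    rw [this, sub_smul]; abel
  rw [h1, norm_smul, norm_inv, norm_norm, ← div_eq_inv_mul]
  gcongr
  refine (norm_add_le _ _).trans ?_
  rw [norm_smul, norm_mul, norm_inv, norm_norm, mul_assoc, inv_mul_cancel₀ hb'.ne', mul_one,
    Real.norm_eq_abs]
  have := abs_norm_sub_norm_le b a
  rw [norm_sub_rev] at this
  linarith

namespace IsSemiconcaveWith

variable {U : En n → ℝ} {P : En n → En n} {C L : ℝ}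

lemma pSecond_mollify_le_of_core (h : IsRadialMollifier ρ b) (hs : IsSemiconcaveWith U P C L)
    (hC : 0 ≤ C) {p : ℝ} (hp : 2 ≤ p) {x : En n} {r τ a c s ω : ℝ}
    (hr : 0 < r) (hτ : ∫ y, (ball x r)ᶜ.indicator (fun y => ρ (x - y)) y ≤ τ)
    (ha : a ≤ (p - 2 + n) * C) (hc : 0 < c) (hs0 : 0 < s) (hps : 2 * p * s ≤ 1)
    (hω : ∀ y ∈ ball x r, ‖P y - P x‖ ≤ ω) (hωτ : 16 * ω + 16 * L * τ ≤ s * c)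
    (hgen : ∀ y ∈ ball x r, ∀ A, HasFDerivAt P A y → P y ≠ 0 →
      pForm p A (‖P y‖⁻¹ • P y) ≤ a)
    (hsmall : ∀ y ∈ ball x r, ‖P y‖ < c → ∀ A, HasFDerivAt P A y →
      ∀ v : En n, ‖v‖ ≤ 1 → pForm p A v ≤ a)
    {v : En n} (hv : ‖v‖ ≤ 1) (hdir : gradient (mollify ρ U) x ≠ 0 →
      v = ‖gradient (mollify ρ U) x‖⁻¹ • gradient (mollify ρ U) x) :
    pSecond p (mollify ρ U) x v ≤ a + (2 * p * s + τ) * ((p - 2 + n) * C - a) := by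
  have hL := hs.bound_nonneg
  have hτ0 : 0 ≤ τ := le_trans (integral_nonneg fun y =>
    indicator_nonneg (fun z _ => h.nonneg _) y) hτ
  have hω0 : 0 ≤ ω := (norm_nonneg _).trans (hω x (mem_ball_self hr))
  have hLτ : 0 ≤ L * τ := mul_nonneg hL hτ0
  have hs1 : s ≤ 1 := by nlinarith
  have hsc : s * c ≤ c := by nlinarith
  set K := (p - 2 + n) * C with hK
  have hps0 : 0 ≤ 2 * p * s := by positivity
  have hcore : ∀ y ∈ ball x r, ∀ A, HasFDerivAt P A y → pForm p A v ≤ a + 2 * p * s * (K - a) := by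
    have hKa : 0 ≤ 2 * p * s * (K - a) := mul_nonneg hps0 (by linarith)
    intro y hy A hA
    rcases lt_or_ge ‖P x‖ (c / 2) with hPx | hPx
    · have h1 : ‖P y‖ < c := by
        have := norm_le_insert' (P y) (P x)
        linarith [hω y hy]
      linarith [hsmall y hy h1 A hA v hv]
    · set D := gradient (mollify ρ U) x with hD
      have hDP : ‖D - P x‖ ≤ ω + 2 * L * τ := hs.norm_gradient_mollify_sub_le h hτ hω0 hω
      have h1 := norm_sub_norm_le (P x) D
      have h2 := norm_sub_norm_le (P x) (P y)
      rw [norm_sub_rev] at h1 h2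
      have hPy := hω y hy
      have hD0 : D ≠ 0 := norm_pos_iff.1 (by nlinarith)
      have hPyc : c / 4 ≤ ‖P y‖ := by nlinarith
      have hPy0 : P y ≠ 0 := norm_pos_iff.1 (by linarith)
      have hne : ∀ z : En n, z ≠ 0 → ‖‖z‖⁻¹ • z‖ = 1 := fun z hz => by
        rw [norm_smul, norm_inv, norm_norm, inv_mul_cancel₀ (norm_pos_iff.2 hz).ne']
      have hDy : ‖P y - D‖ ≤ 2 * ω + 2 * L * τ := by
        have : P y - D = (P y - P x) - (D - P x) := by abel
        rw [this]
        exact (norm_sub_le _ _).trans (by linarith)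
      rw [hdir hD0]
      refine pForm_le_of_norm_sub_le hp (hs.inner_fderiv_le hA) (hne D hD0) (hne _ hPy0) hs0 hs1 ?_
        hps (hgen y hy A hA hPy0)
      refine (norm_normalize_sub_le hPy0 hD0).trans ?_
      rw [div_le_iff₀ (norm_pos_iff.2 hPy0)]
      nlinarith
  refine (hs.pSecond_mollify_le h hC hp hv hτ ?_ hcore).trans ?_
  · nlinarith
  · have : 0 ≤ τ * (2 * p * s * (K - a)) := by
      have : 0 ≤ K - a := by linarith
      positivity
    linarith

end IsSemiconcaveWith

end Directions

section Smoothing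

variable {n : ℕ}

/-- Parabolic rescaling `x ↦ κ² W (x / κ)`. -/
def rescale (κ : ℝ) (W : En n → ℝ) (x : En n) : ℝ := κ ^ 2 * W (κ⁻¹ • x)

lemma fderiv_rescale {κ : ℝ} (hκ : κ ≠ 0) {W : En n → ℝ} (hW : ContDiff ℝ 2 W) (x : En n) :
    fderiv ℝ (rescale κ W) x = κ • fderiv ℝ W (κ⁻¹ • x) := by
  have h1 : rescale κ W = fun x => κ ^ 2 • (fun x => W (κ⁻¹ • x)) x := rfl
  have h2 : DifferentiableAt ℝ (fun x => W (κ⁻¹ • x)) x :=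
    ((hW.differentiable (by norm_num)).comp (differentiable_id.const_smul κ⁻¹)) x
  rw [h1, fderiv_fun_const_smul h2, fderiv_comp_smul, smul_smul]
  congr 1
  field_simp

lemma gradient_rescale {κ : ℝ} (hκ : κ ≠ 0) {W : En n → ℝ} (hW : ContDiff ℝ 2 W) (x : En n) :
    gradient (rescale κ W) x = κ • gradient W (κ⁻¹ • x) := by
  rw [gradient, gradient, fderiv_rescale hκ hW]
  simp

lemma secondDeriv_rescale {κ : ℝ} (hκ : κ ≠ 0) {W : En n → ℝ} (hW : ContDiff ℝ 2 W)
    (x v w : En n) : secondDeriv n (rescale κ W) x v w = secondDeriv n W (κ⁻¹ • x) v w := by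
  have h1 : fderiv ℝ (rescale κ W) = fun x => κ • (fun x => fderiv ℝ W (κ⁻¹ • x)) x := by
    ext1 x; rw [fderiv_rescale hκ hW]
  have h2 : DifferentiableAt ℝ (fun x => fderiv ℝ W (κ⁻¹ • x)) x :=
    ((hW.fderiv_right (m := 1) (by norm_num)).differentiable (by norm_num)).comp
      (differentiable_id.const_smul κ⁻¹) x
  rw [secondDeriv, h1, fderiv_fun_const_smul h2, fderiv_comp_smul, smul_smul,
    mul_inv_cancel₀ hκ, one_smul, secondDeriv]

lemma pSecond_rescale {κ : ℝ} (hκ : κ ≠ 0) {W : En n → ℝ} (hW : ContDiff ℝ 2 W) (p : ℝ)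
    (x v : En n) : pSecond p (rescale κ W) x v = pSecond p W (κ⁻¹ • x) v := by
  simp only [pSecond, laplacian, secondDeriv_rescale hκ hW]

lemma contDiff_rescale (κ : ℝ) {W : En n → ℝ} (hW : ContDiff ℝ 2 W) :
    ContDiff ℝ 2 (rescale κ W) :=
  contDiff_const.mul (hW.comp (contDiff_id.const_smul κ⁻¹))

lemma norm_inv_smul_smul {κ : ℝ} (hκ : 0 < κ) (a : En n) :
    ‖κ • a‖⁻¹ • κ • a = ‖a‖⁻¹ • a := by
  rw [norm_smul, Real.norm_of_nonneg hκ.le, smul_smul, mul_inv]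
  congr 1
  field_simp

namespace IsSemiconcaveWith

variable {U : En n → ℝ} {P : En n → En n} {C L : ℝ}

lemma rescale_inv (hs : IsSemiconcaveWith U P C L) {κ : ℝ} (hκ : 0 < κ) :
    IsSemiconcaveWith (rescale κ⁻¹ U) (fun x => κ⁻¹ • P (κ • x)) C (κ⁻¹ * L) := by
  constructor
  · intro x y
    have h1 := hs.upper (κ • x) (κ • y)
    rw [← smul_sub, real_inner_smul_right, norm_smul, Real.norm_of_nonneg hκ.le] at h1
    simp only [rescale, inv_inv, real_inner_smul_left]
    have h2 := mul_le_mul_of_nonneg_left h1 (by positivity : 0 ≤ κ⁻¹ ^ 2)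
    refine h2.trans (le_of_eq ?_)
    field_simp
  · intro x
    rw [norm_smul, Real.norm_of_nonneg (by positivity)]
    gcongr
    exact hs.bound _

lemma hasFDerivAt_of_rescale {κ : ℝ} (hκ : 0 < κ) {A : En n →L[ℝ] En n} {y : En n}
    (hA : HasFDerivAt (fun x => κ⁻¹ • P (κ • x)) A y) : HasFDerivAt P A (κ • y) := by
  have h1 : HasFDerivAt (fun z : En n => κ⁻¹ • z) (κ⁻¹ • ContinuousLinearMap.id ℝ (En n)) (κ • y) :=
    (hasFDerivAt_id _).const_smul κ⁻¹
  have h2 : HasFDerivAt (fun x => κ⁻¹ • P (κ • x)) A (κ⁻¹ • κ • y) := by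
    rwa [inv_smul_smul₀ hκ.ne']
  have h3 := (h2.comp (κ • y) h1).const_smul κ
  have h4 : (κ • (fun x => κ⁻¹ • P (κ • x)) ∘ fun z : En n => κ⁻¹ • z) = P := by
    ext1 z
    simp [smul_inv_smul₀ hκ.ne']
  rw [h4] at h3
  refine h3.congr_fderiv ?_
  ext1 v
  simp [smul_inv_smul₀ hκ.ne']

set_option maxHeartbeats 400000 in
/-- Smoothing: a semiconcave function whose absolutely continuous Hessian satisfies a
supersolution inequality can be uniformly approximated by `C²` strict supersolutions up to a small
error. -/
lemma exists_smooth_approximation (hs : IsSemiconcaveWith U P C L) (hC : 0 ≤ C) {p : ℝ}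
    (hp : 2 ≤ p) {g : En n → ℝ} (hg : Continuous g) {R R₁ c σ : ℝ} (hR : R < R₁) (hc : 0 < c)
    (hσ : 0 < σ)
    (hgen : ∀ y ∈ ball (0 : En n) R₁, ∀ A, HasFDerivAt P A y → P y ≠ 0 →
      pForm p A (‖P y‖⁻¹ • P y) ≤ -g y + σ)
    (hsmall : ∀ y ∈ ball (0 : En n) R₁, ‖P y‖ < c → ∀ A, HasFDerivAt P A y →
      ∀ v : En n, ‖v‖ ≤ 1 → pForm p A v ≤ -g y + σ) :
    ∃ w : En n → ℝ, ContDiff ℝ 2 w ∧ (∀ x, |w x - U x| ≤ σ) ∧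
      ∀ x ∈ closedBall (0 : En n) R, ∀ v : En n, ‖v‖ ≤ 1 →
        (gradient w x ≠ 0 → v = ‖gradient w x‖⁻¹ • gradient w x) →
        pSecond p w x v ≤ -g x + 4 * σ := by
  obtain ⟨ρ, b, h⟩ := exists_isRadialMollifier n
  have hL := hs.bound_nonneg
  obtain ⟨G, hG⟩ := (isCompact_closedBall (0 : En n) R).exists_bound_of_continuousOn hg.continuousOn
  have hG' : ∀ x ∈ closedBall (0 : En n) R, |g x| ≤ |G| := fun x hx =>
    (hG x hx).trans (le_abs_self G)
  set K : ℝ := (p - 2 + n) * C with hK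
  have hK0 : 0 ≤ K := mul_nonneg (by have := Nat.cast_nonneg (α := ℝ) n; linarith) hC
  have hKG : 0 < K + |G| + 1 := by positivity
  have hp0 : 0 < p := by linarith
  set s : ℝ := min (1 / (2 * p)) (σ / (2 * p * (K + |G| + 1))) with hsdef
  have hs0 : 0 < s := lt_min (by positivity) (by positivity)
  have hps : 2 * p * s ≤ 1 := by
    have := min_le_left (1 / (2 * p)) (σ / (2 * p * (K + |G| + 1)))
    rw [← hsdef, le_div_iff₀ (by positivity)] at this
    linarith
  have hsσ : 2 * p * s * (K + |G| + 1) ≤ σ := by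
    have := min_le_right (1 / (2 * p)) (σ / (2 * p * (K + |G| + 1)))
    rw [← hsdef, le_div_iff₀ (by positivity)] at this
    linarith
  set τ : ℝ := min (σ / (K + |G| + 1)) (s * c / (32 * (L + 1))) with hτdef
  have hτ0 : 0 < τ := lt_min (by positivity) (by positivity)
  have hτσ : τ * (K + |G| + 1) ≤ σ := by
    have := min_le_left (σ / (K + |G| + 1)) (s * c / (32 * (L + 1)))
    rwa [← hτdef, le_div_iff₀ (by positivity)] at this
  have hτL : 32 * L * τ ≤ s * c := by
    have := min_le_right (σ / (K + |G| + 1)) (s * c / (32 * (L + 1)))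
    rw [← hτdef, le_div_iff₀ (by positivity)] at this
    linarith
  obtain ⟨r, hr0, hr1, hr⟩ := h.exists_radius hτ0
  obtain ⟨K', hK'0, hK'⟩ := h.exists_oscillation_bound hr0 hr1
  set M : ℝ := (p - 2) * C + |G| with hM
  have hM0 : 0 ≤ M := by
    have : 0 ≤ p - 2 := by linarith
    positivity
  obtain ⟨δ, hδ, hgδ⟩ : ∃ δ > 0, ∀ x ∈ closedBall (0 : En n) R, ∀ y, dist x y < δ →
      dist (g x) (g y) < σ := by
    have hu := (isCompact_closedBall (0 : En n) (R + 1)).uniformContinuousOn_of_continuous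
      hg.continuousOn
    obtain ⟨δ, hδ, hd⟩ := Metric.uniformContinuousOn_iff.1 hu σ hσ
    refine ⟨min δ 1, lt_min hδ one_pos, fun x hx y hxy => hd x ?_ y ?_ ?_⟩
    · exact closedBall_subset_closedBall (by linarith) hx
    · rw [mem_closedBall] at hx ⊢
      have := dist_triangle y x 0
      rw [dist_comm] at hxy
      linarith [lt_of_lt_of_le hxy (min_le_right δ 1)]
    · exact lt_of_lt_of_le hxy (min_le_left _ _)
  set κ : ℝ :=
    min (min δ (R₁ - R)) (min (σ / (L + 1)) (s * c / (32 * (K' * (C + M) + 1)))) with hκdef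
  have hκ0 : 0 < κ := lt_min (lt_min hδ (by linarith)) (lt_min (by positivity) (by positivity))
  have hκδ : κ ≤ δ := (min_le_left _ _).trans (min_le_left _ _)
  have hκR : κ ≤ R₁ - R := (min_le_left _ _).trans (min_le_right _ _)
  have hκL : κ * (L + 1) ≤ σ := by
    have : κ ≤ σ / (L + 1) := (min_le_right _ _).trans (min_le_left _ _)
    rwa [le_div_iff₀ (by positivity)] at this
  have hκK : κ * (32 * (K' * (C + M) + 1)) ≤ s * c := by
    have : κ ≤ s * c / (32 * (K' * (C + M) + 1)) := (min_le_right _ _).trans (min_le_right _ _)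
    rwa [le_div_iff₀ (by positivity)] at this
  have hκL' : κ * L ≤ σ := by nlinarith
  clear_value κ s τ
  set Û := rescale κ⁻¹ U with hÛ
  set P' : En n → En n := fun x => κ⁻¹ • P (κ • x) with hP'
  have hŝ : IsSemiconcaveWith Û P' C (κ⁻¹ * L) := hs.rescale_inv hκ0
  set W := mollify ρ Û with hW
  have hWs : ContDiff ℝ 2 W := h.contDiff_mollify hŝ.continuous.locallyIntegrable
  refine ⟨rescale κ W, contDiff_rescale κ hWs, fun x => ?_, fun x hx v hv hdir => ?_⟩
  · have h1 := hŝ.abs_mollify_sub_le h (κ⁻¹ • x)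
    have h2 : U x = κ ^ 2 * Û (κ⁻¹ • x) := by
      rw [hÛ, rescale, inv_inv, smul_inv_smul₀ hκ0.ne']
      field_simp
    rw [h2, rescale, ← mul_sub, abs_mul, abs_of_nonneg (by positivity : 0 ≤ κ ^ 2)]
    calc κ ^ 2 * |W (κ⁻¹ • x) - Û (κ⁻¹ • x)| ≤ κ ^ 2 * (κ⁻¹ * L) := by gcongr
      _ = κ * L := by field_simp
      _ ≤ σ := hκL'
  · rw [pSecond_rescale hκ0.ne' hWs]
    rw [gradient_rescale hκ0.ne' hWs] at hdir
    set x' := κ⁻¹ • x with hx'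
    have hxx' : κ • x' = x := by rw [hx', smul_inv_smul₀ hκ0.ne']
    have hgx := abs_le.1 (hG' x hx)
    rcases lt_or_ge (laplacian n W x') (-M) with hlap | hlap
    · have h1 := hŝ.secondDeriv_mollify_le h x' v
      have h2 : C * ‖v‖ ^ 2 ≤ C := by nlinarith [norm_nonneg v, mul_nonneg hC (norm_nonneg v)]
      have h3 := mul_le_mul_of_nonneg_left (h1.trans h2) (by linarith : 0 ≤ p - 2)
      rw [pSecond]
      linarith
    · have hnear : ∀ y ∈ ball x' r, dist x (κ • y) < κ ∧ κ • y ∈ ball (0 : En n) R₁ := by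
        intro y hy
        have h1 : dist (κ • y) x < κ := by
          rw [← hxx', dist_smul₀, Real.norm_of_nonneg hκ0.le]
          rw [mem_ball] at hy
          nlinarith
        refine ⟨by rwa [dist_comm], ?_⟩
        rw [mem_closedBall] at hx
        rw [mem_ball]
        linarith [dist_triangle (κ • y) x 0]
      have hval : ∀ y ∈ ball x' r, -g (κ • y) + σ ≤ -g x + 2 * σ := by
        intro y hy
        have := hgδ x hx (κ • y) ((hnear y hy).1.trans_le hκδ)
        rw [Real.dist_eq, abs_lt] at this
        linarith [this.2]
      have hpn : (0 : ℝ) ≤ K := hK0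
      have key := hŝ.pSecond_mollify_le_of_core h hC hp (x := x') (r := r) (τ := τ)
        (a := min (-g x + 2 * σ) K) (c := κ⁻¹ * c) (s := s) (ω := K' * (C + M)) hr0 (hr x')
        (min_le_right _ _) (by positivity) hs0 hps ?_ ?_ ?_ ?_ hv ?_
      · refine key.trans ?_
        have h1 : K - min (-g x + 2 * σ) K ≤ K + |G| + 1 := by
          have : -|G| - 1 ≤ min (-g x + 2 * σ) K :=
            le_min (by linarith) (by linarith [abs_nonneg G])
          linarith
        have h2 : (2 * p * s + τ) * (K - min (-g x + 2 * σ) K)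
            ≤ (2 * p * s + τ) * (K + |G| + 1) := by gcongr
        linarith [min_le_left (-g x + 2 * σ) K]
      · intro y hy
        have h1 := hK' Û P' C (κ⁻¹ * L) M hŝ hC hM0 x' hlap (y - x')
          (by rw [mem_ball, dist_eq_norm] at hy; exact hy.le)
        rwa [add_sub_cancel] at h1
      · have e1 : 16 * (K' * (C + M)) + 16 * (κ⁻¹ * L) * τ
            = κ⁻¹ * (κ * (16 * (K' * (C + M))) + 16 * L * τ) := by field_simp
        rw [e1]
        have e2 : s * (κ⁻¹ * c) = κ⁻¹ * (s * c) := by ring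
        rw [e2]
        refine mul_le_mul_of_nonneg_left ?_ (by positivity)
        linarith
      · intro y hy A hA hPy
        have h1 := hasFDerivAt_of_rescale hκ0 hA
        refine le_min ?_ ?_
        · have h2 : P (κ • y) ≠ 0 := fun h0 => hPy (by simp [hP', h0])
          have h3 := hgen _ (hnear y hy).2 A h1 h2
          simp only [hP']
          rw [norm_inv_smul_smul (by positivity)]
          exact h3.trans (hval y hy)
        · refine hŝ.pForm_le hC hp hA (le_of_eq ?_)
          rw [norm_smul, norm_inv, norm_norm, inv_mul_cancel₀ (norm_pos_iff.2 hPy).ne']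
      · intro y hy hPc A hA v hv
        have h1 := hasFDerivAt_of_rescale hκ0 hA
        refine le_min ?_ (hŝ.pForm_le hC hp hA hv)
        refine (hsmall _ (hnear y hy).2 ?_ A h1 v hv).trans (hval y hy)
        simp only [hP'] at hPc
        rw [norm_smul, Real.norm_of_nonneg (by positivity)] at hPc
        exact lt_of_mul_lt_mul_left hPc (by positivity)
      · intro h0
        have := hdir (by simpa [hκ0.ne'] using h0)
        rwa [norm_inv_smul_smul hκ0] at this

end IsSemiconcaveWith

end Smoothing

section TestFunctions

variable {n : ℕ}

/-- The supersolution half of `IsViscositySolution`. -/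
def IsViscositySupersolution (p : ℝ) (Ω : Set (En n)) (g u : En n → ℝ) : Prop :=
  ∀ x ∈ Ω, ∀ φ : En n → ℝ, ContDiffAt ℝ 2 φ x → φ x = u x →
    (∀ᶠ y in nhds x, φ y ≤ u y) →
    (gradient φ x ≠ 0 ∨ fderiv ℝ (fderiv ℝ φ) x = 0) →
    g x ≤ -normalizedPLaplacian n p φ x

/-- The quadratic polynomial with value `a`, gradient `P` and Hessian the symmetrization of `B`
at `y`. -/
def quadraticAt (a : ℝ) (P y : En n) (B : En n →L[ℝ] En n) (z : En n) : ℝ :=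
  a + ⟪P, z - y⟫ + 1 / 2 * ⟪B (z - y), z - y⟫

lemma contDiff_quadraticAt (a : ℝ) (P y : En n) (B : En n →L[ℝ] En n) :
    ContDiff ℝ 2 (quadraticAt a P y B) := by
  have h : ContDiff ℝ 2 fun z : En n => z - y := contDiff_id.sub contDiff_const
  exact (contDiff_const.add (contDiff_const.inner ℝ h)).add
    (contDiff_const.mul ((B.contDiff.comp h).inner ℝ h))

lemma fderiv_quadraticAt (a : ℝ) (P y : En n) (B : En n →L[ℝ] En n) (z v : En n) :
    fderiv ℝ (quadraticAt a P y B) z v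
      = ⟪P, v⟫ + 1 / 2 * (⟪B (z - y), v⟫ + ⟪B v, z - y⟫) := by
  have h : HasFDerivAt (fun z : En n => z - y) (ContinuousLinearMap.id ℝ (En n)) z :=
    (hasFDerivAt_id z).sub_const y
  have h1 := (hasFDerivAt_const P z).inner ℝ h
  have h2 := (B.hasFDerivAt.comp z h).inner ℝ h
  have h3 := (h1.const_add a).add (h2.const_mul (1 / 2 : ℝ))
  have h4 : fderiv ℝ (quadraticAt a P y B) z = _ := h3.fderiv
  rw [h4]
  simp

lemma secondDeriv_quadraticAt (a : ℝ) (P y : En n) (B : En n →L[ℝ] En n) (v : En n) :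
    secondDeriv n (quadraticAt a P y B) y v v = ⟪B v, v⟫ := by
  have hd : DifferentiableAt ℝ (fderiv ℝ (quadraticAt a P y B)) y :=
    ((contDiff_quadraticAt a P y B).fderiv_right (m := 1) (by norm_num)).differentiable
      (by norm_num) y
  have h0 : secondDeriv n (quadraticAt a P y B) y v v
      = fderiv ℝ (fun z => fderiv ℝ (quadraticAt a P y B) z v) y v := by
    rw [secondDeriv, fderiv_clm_apply hd (differentiableAt_const v)]
    simp
  have h : HasFDerivAt (fun z : En n => z - y) (ContinuousLinearMap.id ℝ (En n)) y :=
    (hasFDerivAt_id y).sub_const y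
  have h1 := (B.hasFDerivAt.comp y h).inner ℝ (hasFDerivAt_const v y)
  have h2 := (hasFDerivAt_const (B v) y).inner ℝ h
  have h3 := ((h1.add h2).const_mul (1 / 2 : ℝ)).const_add ⟪P, v⟫
  have hfun : (fun z => fderiv ℝ (quadraticAt a P y B) z v)
      = fun z => ⟪P, v⟫ + 1 / 2 * (⟪B (z - y), v⟫ + ⟪B v, z - y⟫) :=
    funext fun z => fderiv_quadraticAt a P y B z v
  have h4 : fderiv ℝ (fun z => ⟪P, v⟫ + 1 / 2 * (⟪B (z - y), v⟫ + ⟪B v, z - y⟫)) y = _ :=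
    h3.fderiv
  rw [h0, hfun, h4]
  simp
  ring

lemma gradient_quadraticAt (a : ℝ) (P y : En n) (B : En n →L[ℝ] En n) :
    gradient (quadraticAt a P y B) y = P := by
  refine ext_inner_right ℝ fun v => ?_
  rw [real_inner_gradient, fderiv_quadraticAt]
  simp

lemma IsViscositySupersolution.le_of_quadratic {p : ℝ} (hp : 0 < p) {Ω : Set (En n)}
    {g u : En n → ℝ} (hu : IsViscositySupersolution p Ω g u) {y P : En n}
    (hy : y ∈ Ω) (hP : P ≠ 0) {A : En n →L[ℝ] En n}
    (hA : ∀ θ : ℝ, 0 < θ → ∀ᶠ v in 𝓝 (0 : En n),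
      u y + ⟪P, v⟫ + 1 / 2 * ⟪A v, v⟫ - θ * ‖v‖ ^ 2 ≤ u (y + v)) :
    pForm p A (‖P‖⁻¹ • P) ≤ -(p * g y) := by
  have hP' : 0 < ‖P‖ := norm_pos_iff.2 hP
  have key : ∀ θ : ℝ, 0 < θ → pForm p A (‖P‖⁻¹ • P) ≤ -(p * g y) + θ * (2 * (p - 2 + n)) := by
    intro θ hθ
    set B : En n →L[ℝ] En n := A - (2 * θ) • ContinuousLinearMap.id ℝ (En n) with hB
    have hBv : ∀ v, ⟪B v, v⟫ = ⟪A v, v⟫ - 2 * θ * ‖v‖ ^ 2 := fun v => by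
      simp [hB, inner_sub_left, real_inner_smul_left]
    have htouch : ∀ᶠ z in 𝓝 y, quadraticAt (u y) P y B z ≤ u z := by
      have h1 : Tendsto (fun z => z - y) (𝓝 y) (𝓝 0) := by
        have : Continuous fun z : En n => z - y := continuous_id.sub continuous_const
        simpa using this.tendsto y
      filter_upwards [h1.eventually (hA θ hθ)] with z hz
      rw [add_sub_cancel] at hz
      rw [quadraticAt, hBv]
      linarith
    have h1 := hu y hy _ (contDiff_quadraticAt (u y) P y B).contDiffAt
      (by simp [quadraticAt]) htouch (Or.inl (by rwa [gradient_quadraticAt]))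
    rw [normalizedPLaplacian, gradient_quadraticAt, if_neg hP, laplacian] at h1
    simp only [secondDeriv_quadraticAt, hBv] at h1
    rw [Finset.sum_sub_distrib] at h1
    have h2 : ∑ i : Fin n, 2 * θ * ‖EuclideanSpace.basisFun (Fin n) ℝ i‖ ^ 2 = 2 * θ * n := by
      simp [mul_comm]
    rw [h2] at h1
    have h3 : p * g y ≤ -((p - 2) * (⟪A P, P⟫ - 2 * θ * ‖P‖ ^ 2) / ‖P‖ ^ 2
      + (∑ i : Fin n, ⟪A (EuclideanSpace.basisFun (Fin n) ℝ i),
        EuclideanSpace.basisFun (Fin n) ℝ i⟫ - 2 * θ * n)) := by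
      have := mul_le_mul_of_nonneg_left h1 hp.le
      refine this.trans (le_of_eq ?_)
      field_simp
    have h4 : (p - 2) * (⟪A P, P⟫ - 2 * θ * ‖P‖ ^ 2) / ‖P‖ ^ 2
        = (p - 2) * (‖P‖⁻¹ * (‖P‖⁻¹ * ⟪A P, P⟫)) - (p - 2) * (2 * θ) := by
      field_simp
    rw [h4] at h3
    rw [pForm, map_smul, real_inner_smul_left, real_inner_smul_right]
    linarith
  refine le_of_forall_pos_le_add fun η hη => ?_
  have h1 := key (η / (2 * (|p - 2| + n) + 1)) (by positivity)
  refine h1.trans (add_le_add le_rfl ?_)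
  rw [div_mul_eq_mul_div, div_le_iff₀ (by positivity)]
  have := le_abs_self (p - 2)
  nlinarith

lemma IsViscositySupersolution.nonpos_of_quartic {p : ℝ} {Ω : Set (En n)}
    {g u : En n → ℝ} (hu : IsViscositySupersolution p Ω g u) {x : En n}
    (hx : x ∈ Ω) {N : ℝ} (hN : ∀ z, u x ≤ u z + N * ‖x - z‖ ^ 4) : g x ≤ 0 := by
  set φ : En n → ℝ := fun z => u x - N * (‖z - x‖ ^ 2) ^ 2 with hφ
  have h : ∀ z : En n, HasFDerivAt (fun z : En n => z - x) (ContinuousLinearMap.id ℝ (En n)) z :=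
    fun z => (hasFDerivAt_id z).sub_const x
  have hsq : ∀ z : En n, HasFDerivAt (fun z : En n => ‖z - x‖ ^ 2) (2 • innerSL ℝ (z - x)) z := by
    intro z
    exact ((hasStrictFDerivAt_norm_sq (z - x)).hasFDerivAt).comp z (h z)
  have hfd : fderiv ℝ φ = fun z => (-(4 * N) * ‖z - x‖ ^ 2) • innerSL ℝ (z - x) := by
    ext1 z
    have h1 := (((hsq z).pow 2).const_mul N).const_sub (u x)
    have h2 : fderiv ℝ φ z = _ := h1.fderiv
    rw [h2]
    ext v
    simp
    ring
  have hfd2 : fderiv ℝ (fderiv ℝ φ) x = 0 := by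
    rw [hfd]
    have h1 : HasFDerivAt (fun z : En n => innerSL ℝ (z - x))
        ((innerSL ℝ : En n →L[ℝ] _).comp (ContinuousLinearMap.id ℝ (En n))) x :=
      ((innerSL ℝ : En n →L[ℝ] (En n →L[ℝ] ℝ)).hasFDerivAt).comp x (h x)
    have h2 := ((hsq x).const_mul (-(4 * N))).smul h1
    have h3 : fderiv ℝ (fun z => (-(4 * N) * ‖z - x‖ ^ 2) • innerSL ℝ (z - x)) x = _ := h2.fderiv
    rw [h3]
    ext v w
    simp
  have hgrad : gradient φ x = 0 := by
    rw [gradient, hfd]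
    simp
  have hc : ContDiff ℝ 2 φ :=
    contDiff_const.sub (contDiff_const.mul (((contDiff_id.sub contDiff_const).norm_sq ℝ).pow 2))
  have h1 := hu x hx φ hc.contDiffAt (by simp [hφ])
    (Eventually.of_forall fun z => by
      have h2 := hN z
      rw [norm_sub_rev] at h2
      simp only [hφ, ← pow_mul]
      norm_num
      linarith) (Or.inr hfd2)
  rwa [normalizedPLaplacian, if_pos hgrad, neg_zero] at h1

end TestFunctions

section InfConvolution

variable {n : ℕ}

lemma quartic_expansion_le {N : ℝ} (hN : 0 ≤ N) (d h : En n) :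
    N * ‖d + h‖ ^ 4 ≤ N * ‖d‖ ^ 4 + ⟪(4 * N * ‖d‖ ^ 2) • d, h⟫
      + N * (8 * ‖d‖ ^ 2 * ‖h‖ ^ 2 + 3 * ‖h‖ ^ 4) := by
  have h1 : ‖d + h‖ ^ 4 = (‖d‖ ^ 2 + 2 * ⟪d, h⟫ + ‖h‖ ^ 2) ^ 2 := by
    rw [← norm_add_sq_real]
    ring
  have h2 := abs_real_inner_le_norm d h
  have h3 : ⟪d, h⟫ ^ 2 ≤ ‖d‖ ^ 2 * ‖h‖ ^ 2 := by
    rw [← mul_pow, ← sq_abs]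
    gcongr
  have h4 : ⟪d, h⟫ * ‖h‖ ^ 2 ≤ ‖d‖ * ‖h‖ * ‖h‖ ^ 2 :=
    mul_le_mul_of_nonneg_right ((le_abs_self _).trans h2) (by positivity)
  rw [h1, real_inner_smul_left]
  have h5 : (‖d‖ ^ 2 + 2 * ⟪d, h⟫ + ‖h‖ ^ 2) ^ 2
      ≤ ‖d‖ ^ 4 + 4 * ‖d‖ ^ 2 * ⟪d, h⟫ + (8 * ‖d‖ ^ 2 * ‖h‖ ^ 2 + 3 * ‖h‖ ^ 4) := by
    nlinarith [sq_nonneg ((‖d‖ - ‖h‖) * ‖h‖)]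
  nlinarith

/-- `U` is the infimal convolution of `u` with the kernel `N ‖·‖⁴`, the infimum at `x` being
attained at the point `Y x`, at distance at most `D` from `x`. -/
structure IsInfConvolution (N D : ℝ) (u U : En n → ℝ) (Y : En n → En n) : Prop where
  le : ∀ x z, U x ≤ u z + N * ‖x - z‖ ^ 4
  eq : ∀ x, U x = u (Y x) + N * ‖x - Y x‖ ^ 4
  norm_le : ∀ x, ‖x - Y x‖ ≤ D

lemma exists_isInfConvolution {u : En n → ℝ} (hu : Continuous u) {M N D : ℝ}
    (hM : ∀ x, |u x| ≤ M) (hN : 0 ≤ N) (hD : 0 ≤ D) (hND : 2 * M ≤ N * D ^ 4) :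
    ∃ U Y, IsInfConvolution N D u U Y := by
  have h : ∀ x, ∃ y ∈ closedBall x D,
      ∀ z ∈ closedBall x D, u y + N * ‖x - y‖ ^ 4 ≤ u z + N * ‖x - z‖ ^ 4 := fun x =>
    (isCompact_closedBall x D).exists_isMinOn ⟨x, mem_closedBall_self hD⟩
      (f := fun y => u y + N * ‖x - y‖ ^ 4) (by fun_prop)
  choose Y hY hmin using h
  refine ⟨fun x => u (Y x) + N * ‖x - Y x‖ ^ 4, Y, fun x z => ?_, fun x => rfl, fun x => ?_⟩
  · by_cases hz : z ∈ closedBall x D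
    · exact hmin x z hz
    · have h1 := hmin x x (mem_closedBall_self hD)
      rw [sub_self, norm_zero, zero_pow (by norm_num), mul_zero, add_zero] at h1
      have h2 : D ≤ ‖x - z‖ := by
        rw [mem_closedBall, dist_eq_norm, norm_sub_rev] at hz
        exact (not_le.1 hz).le
      have h3 : N * D ^ 4 ≤ N * ‖x - z‖ ^ 4 := by gcongr
      have h4 := abs_le.1 (hM x)
      have h5 := abs_le.1 (hM z)
      change u (Y x) + N * ‖x - Y x‖ ^ 4 ≤ _
      linarith
  · have := hY x
    rwa [mem_closedBall, dist_eq_norm, norm_sub_rev] at this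

namespace IsInfConvolution

variable {N D : ℝ} {u U : En n → ℝ} {Y : En n → En n}

lemma le_self (h : IsInfConvolution N D u U Y) (x : En n) : U x ≤ u x := by
  simpa using h.le x x

lemma self_le (h : IsInfConvolution N D u U Y) (hN : 0 ≤ N) (x : En n) : u (Y x) ≤ U x := by
  rw [h.eq x]
  have : 0 ≤ N * ‖x - Y x‖ ^ 4 := by positivity
  linarith

lemma upper (h : IsInfConvolution N D u U Y) (hN : 0 ≤ N) (x v : En n) :
    U (x + v) ≤ U x + ⟪(4 * N * ‖x - Y x‖ ^ 2) • (x - Y x), v⟫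
      + N * (8 * ‖x - Y x‖ ^ 2 * ‖v‖ ^ 2 + 3 * ‖v‖ ^ 4) := by
  have h1 := h.le (x + v) (Y x)
  rw [add_sub_right_comm] at h1
  have h2 := quartic_expansion_le hN (x - Y x) v
  have h3 := h.eq x
  linarith

lemma isSemiconcaveWith (h : IsInfConvolution N D u U Y) (hN : 0 ≤ N) {M : ℝ}
    (hM : ∀ x, |u x| ≤ M) :
    IsSemiconcaveWith U (fun x => (4 * N * ‖x - Y x‖ ^ 2) • (x - Y x))
      (2 * (N * (8 * D ^ 2 + 3) + 2 * M + 4 * N * D ^ 3)) (4 * N * D ^ 3) := by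
  have hb : ∀ x, ‖(4 * N * ‖x - Y x‖ ^ 2) • (x - Y x)‖ ≤ 4 * N * D ^ 3 := fun x => by
    rw [norm_smul, Real.norm_eq_abs, abs_of_nonneg (by positivity), mul_assoc, ← pow_succ]
    have := h.norm_le x
    gcongr
  have hM0 : 0 ≤ M := (abs_nonneg _).trans (hM 0)
  refine ⟨fun x y => ?_, hb⟩
  have hD : 0 ≤ D := (norm_nonneg _).trans (h.norm_le x)
  obtain ⟨v, rfl⟩ : ∃ v, y = x + v := ⟨y - x, by abel⟩
  rw [add_sub_cancel_left]
  rcases le_total ‖v‖ 1 with hv | hv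
  · have h1 := h.upper hN x v
    have h2 : ‖v‖ ^ 4 ≤ ‖v‖ ^ 2 := pow_le_pow_of_le_one (norm_nonneg v) hv (by norm_num)
    have h3 : N * (8 * ‖x - Y x‖ ^ 2 * ‖v‖ ^ 2 + 3 * ‖v‖ ^ 4)
        ≤ N * (8 * D ^ 2 * ‖v‖ ^ 2 + 3 * ‖v‖ ^ 2) := by
      have := h.norm_le x
      gcongr
    have h4 : 0 ≤ (2 * M + 4 * N * D ^ 3) * ‖v‖ ^ 2 := by positivity
    linarith
  · have h1 := abs_le.1 (hM (x + v))
    have h2 := abs_le.1 (hM (Y x))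
    have h3 := h.le_self (x + v)
    have h4 := h.self_le hN x
    have h5 := (abs_le.1 ((abs_real_inner_le_norm _ v).trans
      (mul_le_mul_of_nonneg_right (hb x) (norm_nonneg v)))).1
    have h6 : 1 ≤ ‖v‖ ^ 2 := one_le_pow₀ hv
    have h7 : ‖v‖ ≤ ‖v‖ ^ 2 := by nlinarith
    have h8 : 0 ≤ N * (8 * D ^ 2 + 3) * ‖v‖ ^ 2 := by positivity
    have h9 : 4 * N * D ^ 3 * ‖v‖ ≤ 4 * N * D ^ 3 * ‖v‖ ^ 2 := by gcongr
    have h10 : 2 * M * 1 ≤ 2 * M * ‖v‖ ^ 2 := by gcongr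
    linarith

lemma eventually_lower_expansion (h : IsInfConvolution N D u U Y) (hN : 0 ≤ N) {M : ℝ}
    (hM : ∀ x, |u x| ≤ M) {x : En n} {A : En n →L[ℝ] En n}
    (hA : HasFDerivAt (fun x => (4 * N * ‖x - Y x‖ ^ 2) • (x - Y x)) A x) {θ : ℝ} (hθ : 0 < θ) :
    ∀ᶠ v in 𝓝 (0 : En n), u (Y x) + ⟪(4 * N * ‖x - Y x‖ ^ 2) • (x - Y x), v⟫
      + 1 / 2 * ⟪A v, v⟫ - θ * ‖v‖ ^ 2 ≤ u (Y x + v) := by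
  filter_upwards [(h.isSemiconcaveWith hN hM).eventually_lower_expansion hA hθ] with v hv
  have h1 := h.le (x + v) (Y x + v)
  rw [add_sub_add_right_eq_sub] at h1
  have h2 := h.eq x
  linarith

lemma inner_fderiv_le (h : IsInfConvolution N D u U Y) (hN : 0 ≤ N) {M : ℝ}
    (hM : ∀ x, |u x| ≤ M) {x : En n} {A : En n →L[ℝ] En n}
    (hA : HasFDerivAt (fun x => (4 * N * ‖x - Y x‖ ^ 2) • (x - Y x)) A x) (w : En n) :
    ⟪A w, w⟫ ≤ 16 * N * ‖x - Y x‖ ^ 2 * ‖w‖ ^ 2 := by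
  have key : ∀ θ : ℝ, 0 < θ →
      ⟪A w, w⟫ ≤ 16 * N * ‖x - Y x‖ ^ 2 * ‖w‖ ^ 2 + θ * (2 * ‖w‖ ^ 2 + 6 * N * ‖w‖ ^ 4) := by
    intro θ hθ
    have h1 := (h.isSemiconcaveWith hN hM).eventually_lower_expansion hA hθ
    have h2 : Tendsto (fun t : ℝ => t • w) (𝓝[>] 0) (𝓝 0) := by
      have : Continuous fun t : ℝ => t • w := by fun_prop
      simpa using (this.tendsto 0).mono_left nhdsWithin_le_nhds
    have h3 : ∀ᶠ t : ℝ in 𝓝[>] 0, t ^ 2 < θ := by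
      have : Continuous fun t : ℝ => t ^ 2 := by fun_prop
      have h4 : Tendsto (fun t : ℝ => t ^ 2) (𝓝[>] 0) (𝓝 0) := by
        simpa using (this.tendsto 0).mono_left nhdsWithin_le_nhds
      exact h4.eventually (gt_mem_nhds hθ)
    obtain ⟨t, ht, htθ, ht0⟩ := ((h2.eventually h1).and (h3.and self_mem_nhdsWithin)).exists
    have h5 := ht.trans (h.upper hN x (t • w))
    rw [map_smul, real_inner_smul_left (A w), real_inner_smul_right (A w), norm_smul,
      Real.norm_eq_abs, abs_of_pos ht0] at h5
    have h6 : t ^ 2 * (1 / 2 * ⟪A w, w⟫) ≤ t ^ 2 * (θ * ‖w‖ ^ 2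
        + N * (8 * ‖x - Y x‖ ^ 2 * ‖w‖ ^ 2 + 3 * t ^ 2 * ‖w‖ ^ 4)) := by linarith
    have h7 := le_of_mul_le_mul_left h6 (by positivity)
    have h8 : 3 * N * ‖w‖ ^ 4 * t ^ 2 ≤ 3 * N * ‖w‖ ^ 4 * θ := by gcongr
    linarith
  refine le_of_forall_pos_le_add fun η hη => ?_
  have h1 := key (η / (2 * ‖w‖ ^ 2 + 6 * N * ‖w‖ ^ 4 + 1)) (by positivity)
  refine h1.trans (add_le_add le_rfl ?_)
  have h2 : 0 ≤ 2 * ‖w‖ ^ 2 + 6 * N * ‖w‖ ^ 4 := by positivity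
  rw [div_mul_eq_mul_div, div_le_iff₀ (by positivity)]
  nlinarith

end IsInfConvolution

lemma lt_of_mul_pow_three_lt {N a b : ℝ} (hN : 0 ≤ N) (hb : 0 ≤ b)
    (h : 4 * N * a ^ 3 < 4 * N * b ^ 3) : a < b :=
  lt_of_pow_lt_pow_left₀ 3 hb (lt_of_mul_lt_mul_left h (by positivity))

/-- A viscosity supersolution whose right-hand side has a sign is approximated by `C²` functions
that are supersolutions up to a small error. -/
lemma IsViscositySupersolution.exists_smooth_approximation {p : ℝ} (hp : 2 ≤ p) {R R₁ R₂ : ℝ}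
    (hR : R < R₁) (hR₁ : R₁ < R₂) {u g : En n → ℝ} (hu : Continuous u) {M : ℝ}
    (hM : ∀ x, |u x| ≤ M) (hg : Continuous g)
    (hsup : IsViscositySupersolution p (ball (0 : En n) R₂) g u)
    (hsign : (∀ x ∈ closedBall (0 : En n) R₁, 0 < g x) ∨
      ∀ x ∈ closedBall (0 : En n) R₁, g x ≤ 0) {σ : ℝ} (hσ : 0 < σ) :
    ∃ w : En n → ℝ, ContDiff ℝ 2 w ∧ (∀ x ∈ closedBall (0 : En n) R₁, |w x - u x| ≤ σ) ∧
      ∀ x ∈ closedBall (0 : En n) R, ∀ v : En n, ‖v‖ ≤ 1 →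
        (gradient w x ≠ 0 → v = ‖gradient w x‖⁻¹ • gradient w x) →
        pSecond p w x v ≤ -(p * g x) + σ := by
  have hM0 : 0 ≤ M := (abs_nonneg _).trans (hM 0)
  have huc : ∀ F : En n → ℝ, Continuous F → ∀ η : ℝ, 0 < η → ∃ δ > 0,
      ∀ x ∈ closedBall (0 : En n) R₂, ∀ y ∈ closedBall (0 : En n) R₂, ‖x - y‖ < δ →
        |F x - F y| < η := by
    intro F hF η hη
    obtain ⟨δ, hδ, h⟩ := Metric.uniformContinuousOn_iff.1
      ((isCompact_closedBall (0 : En n) R₂).uniformContinuousOn_of_continuous hF.continuousOn) η hη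
    exact ⟨δ, hδ, fun x hx y hy hxy => by
      simpa [Real.dist_eq] using h x hx y hy (by rwa [dist_eq_norm])⟩
  obtain ⟨δ₁, hδ₁, huδ⟩ := huc u hu (σ / 4) (by positivity)
  obtain ⟨δ₂, hδ₂, hgδ⟩ := huc (fun x => p * g x) (hg.const_mul p) (σ / 4) (by positivity)
  obtain ⟨D, hD, hDlt⟩ : ∃ D, 0 < D ∧ D < min (min δ₁ δ₂) (R₂ - R₁) :=
    exists_between (lt_min (lt_min hδ₁ hδ₂) (by linarith))
  rw [lt_min_iff, lt_min_iff] at hDlt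
  obtain ⟨⟨hD₁, hD₂⟩, hD₃⟩ := hDlt
  set N : ℝ := (2 * M + 1) / D ^ 4 with hNdef
  have hN : 0 < N := by positivity
  obtain ⟨U, Y, hU⟩ := exists_isInfConvolution hu hM hN.le hD.le
    (by rw [hNdef, div_mul_cancel₀ _ (by positivity)]; linarith)
  have hs := hU.isSemiconcaveWith hN.le hM
  have hYmem : ∀ x ∈ closedBall (0 : En n) R₁, Y x ∈ ball (0 : En n) R₂ := fun x hx => by
    rw [mem_closedBall_zero_iff] at hx
    rw [mem_ball_zero_iff]
    have h1 := hU.norm_le x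
    have h2 := norm_sub_norm_le (Y x) x
    rw [norm_sub_rev] at h2
    linarith
  have hsub : closedBall (0 : En n) R₁ ⊆ closedBall 0 R₂ := closedBall_subset_closedBall hR₁.le
  have hPnorm : ∀ x, ‖(4 * N * ‖x - Y x‖ ^ 2) • (x - Y x)‖ = 4 * N * ‖x - Y x‖ ^ 3 := fun x => by
    rw [norm_smul, Real.norm_eq_abs, abs_of_nonneg (by positivity)]
    ring
  have hgen : ∀ y ∈ ball (0 : En n) R₁, ∀ A,
      HasFDerivAt (fun x => (4 * N * ‖x - Y x‖ ^ 2) • (x - Y x)) A y →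
      (4 * N * ‖y - Y y‖ ^ 2) • (y - Y y) ≠ 0 →
      pForm p A (‖(4 * N * ‖y - Y y‖ ^ 2) • (y - Y y)‖⁻¹ •
        ((4 * N * ‖y - Y y‖ ^ 2) • (y - Y y))) ≤ -(p * g y) + σ / 4 := by
    intro y hy A hA hP
    have hy' := ball_subset_closedBall hy
    have h1 := hsup.le_of_quadratic (by linarith) (hYmem y hy') hP
      fun θ hθ => hU.eventually_lower_expansion hN.le hM hA hθ
    have h2 := (abs_lt.1 (hgδ y (hsub hy') (Y y) (ball_subset_closedBall (hYmem y hy'))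
      ((hU.norm_le y).trans_lt hD₂))).2
    linarith
  obtain ⟨c, hc, hsmall⟩ : ∃ c : ℝ, 0 < c ∧ ∀ y ∈ ball (0 : En n) R₁,
      ‖(4 * N * ‖y - Y y‖ ^ 2) • (y - Y y)‖ < c → ∀ A,
      HasFDerivAt (fun x => (4 * N * ‖x - Y x‖ ^ 2) • (x - Y x)) A y →
      ∀ v : En n, ‖v‖ ≤ 1 → pForm p A v ≤ -(p * g y) + σ / 4 := by
    rcases hsign with hpos | hneg
    · obtain ⟨m, hm, hmle⟩ := (isCompact_closedBall (0 : En n) R₁).exists_forall_le'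
        (f := fun x => u x - U x) (hu.sub hs.continuous).continuousOn (a := 0) fun x hx => by
          by_contra hcon
          have h1 := hsup.nonpos_of_quartic (N := N)
            (closedBall_subset_ball hR₁ hx) fun z => (by linarith : u x ≤ U x).trans (hU.le x z)
          exact absurd (hpos x hx) (not_lt.2 h1)
      obtain ⟨δ, hδ, huδ'⟩ := huc u hu m hm
      refine ⟨4 * N * δ ^ 3, by positivity, fun y hy hPy => ?_⟩
      rw [hPnorm] at hPy
      have hy' := ball_subset_closedBall hy
      have h1 := (abs_lt.1 (huδ' y (hsub hy') (Y y) (ball_subset_closedBall (hYmem y hy'))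
        (lt_of_mul_pow_three_lt hN.le hδ.le hPy))).2
      have h2 := hmle y hy'
      have h3 := hU.self_le hN.le y
      linarith
    · set K : ℝ := (p - 2 + n) * (16 * N) with hK
      have hK0 : 0 ≤ K := by
        have : 0 ≤ p - 2 := by linarith
        positivity
      obtain ⟨δ, hδ, hδK⟩ : ∃ δ : ℝ, 0 < δ ∧ K * δ ^ 2 ≤ σ / 4 := by
        refine ⟨min 1 (σ / 4 / (K + 1)), by positivity, ?_⟩
        have h1 : min 1 (σ / 4 / (K + 1)) ^ 2 ≤ σ / 4 / (K + 1) := by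
          rw [sq]
          exact (mul_le_mul (min_le_left _ _) (min_le_right _ _) (by positivity)
            zero_le_one).trans (one_mul _).le
        refine (mul_le_mul_of_nonneg_left h1 hK0).trans ?_
        rw [mul_div_assoc', div_le_iff₀ (by positivity)]
        nlinarith
      refine ⟨4 * N * δ ^ 3, by positivity, fun y hy hPy A hA v hv => ?_⟩
      rw [hPnorm] at hPy
      have h1 := (lt_of_mul_pow_three_lt hN.le hδ.le hPy).le
      have h2 := pForm_le_of_inner_le hp (by positivity) (hU.inner_fderiv_le hN.le hM hA) hv
      have h3 : K * ‖y - Y y‖ ^ 2 ≤ K * δ ^ 2 := by gcongr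
      have h4 := mul_nonneg (by linarith : 0 ≤ p)
        (neg_nonneg.2 (hneg y (ball_subset_closedBall hy)))
      have h5 : (p - 2 + n) * (16 * N * ‖y - Y y‖ ^ 2) = K * ‖y - Y y‖ ^ 2 := by rw [hK]; ring
      linarith
  obtain ⟨w, hw, hwU, hw2⟩ := hs.exists_smooth_approximation (by positivity) hp
    (hg.const_mul p) hR hc (by positivity : 0 < σ / 4) hgen hsmall
  refine ⟨w, hw, fun x hx => ?_, fun x hx v hv hgv => ?_⟩
  · have h1 := abs_le.1 (hwU x)
    have h2 := hU.le_self x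
    have h3 := hU.self_le hN.le x
    have h4 := abs_lt.1 (huδ x (hsub hx) (Y x) (ball_subset_closedBall (hYmem x hx))
      ((hU.norm_le x).trans_lt hD₁))
    rw [abs_le]
    constructor <;> linarith
  · have := hw2 x hx v hv hgv
    linarith

end InfConvolution

section BallAverages

variable {n : ℕ}

lemma volume_real_ball_pos (x : En n) {ε : ℝ} (hε : 0 < ε) : 0 < volume.real (ball x ε) :=
  ENNReal.toReal_pos (measure_ball_pos volume x hε).ne' measure_ball_lt_top.ne

lemma setIntegral_ball_comp_linearIsometryEquiv (T : En n ≃ₗᵢ[ℝ] En n) (F : En n → ℝ) (ε : ℝ) :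
    ∫ z in ball (0 : En n) ε, F (T z) = ∫ z in ball (0 : En n) ε, F z := by
  have h := T.measurePreserving.setIntegral_preimage_emb T.toHomeomorph.measurableEmbedding F
    (ball 0 ε)
  rwa [T.preimage_ball, map_zero] at h

lemma setIntegral_ball_norm_pow (hn : 0 < n) {ε : ℝ} (hε : 0 < ε) (k : ℕ) :
    ∫ z in ball (0 : En n) ε, ‖z‖ ^ k
      = n * volume.real (ball (0 : En n) 1) * (ε ^ (n + k) / (n + k)) := by
  have : Nonempty (Fin n) := ⟨⟨0, hn⟩⟩
  have h1 : (ball (0 : En n) ε).indicator (fun z => ‖z‖ ^ k)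
      = fun z => (Iio ε).indicator (fun r => r ^ k) ‖z‖ := by
    ext z
    simp [indicator]
  have h2 : ∀ y : ℝ, y ^ (n - 1) • (Iio ε).indicator (fun r => r ^ k) y
      = (Iio ε).indicator (fun r => r ^ (n - 1 + k)) y := by
    intro y
    by_cases hy : y ∈ Iio ε <;> simp [hy, pow_add]
  rw [← integral_indicator measurableSet_ball, h1,
    integral_fun_norm_addHaar volume fun r => (Iio ε).indicator (fun r => r ^ k) r,
    finrank_euclideanSpace_fin]
  simp_rw [h2]
  rw [setIntegral_indicator measurableSet_Iio, Ioi_inter_Iio, ← integral_Ioc_eq_integral_Ioo,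
    ← intervalIntegral.integral_of_le hε.le, integral_pow, zero_pow (by omega), sub_zero,
    smul_eq_mul, nsmul_eq_mul, show n - 1 + k + 1 = n + k by omega]
  have h3 : ((n - 1 + k : ℕ) : ℝ) + 1 = n + k := by
    rw [← Nat.cast_succ, show (n - 1 + k).succ = n + k by omega, Nat.cast_add]
  rw [h3, mul_assoc]

lemma setIntegral_ball_coord_mul_coord {i j : Fin n} (hij : i ≠ j) (ε : ℝ) :
    ∫ z in ball (0 : En n) ε, z i * z j = 0 := by
  have h := setIntegral_ball_comp_linearIsometryEquiv
    (LinearIsometryEquiv.piLpCongrRight 2 fun k : Fin n =>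
      if k = i then LinearIsometryEquiv.neg ℝ else LinearIsometryEquiv.refl ℝ ℝ)
    (fun z : En n => z i * z j) ε
  simp [hij.symm, integral_neg] at h
  linarith

lemma setIntegral_ball_coord_sq (i j : Fin n) (ε : ℝ) :
    ∫ z in ball (0 : En n) ε, z i * z i = ∫ z in ball (0 : En n) ε, z j * z j := by
  have h := setIntegral_ball_comp_linearIsometryEquiv
    (LinearIsometryEquiv.piLpCongrLeft 2 ℝ ℝ (Equiv.swap i j))
    (fun z : En n => z j * z j) ε
  simpa [LinearIsometryEquiv.piLpCongrLeft_apply] using h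

lemma integrableOn_ball_of_continuous {F : En n → ℝ} (hF : Continuous F) (x : En n) (ε : ℝ) :
    IntegrableOn F (ball x ε) :=
  (hF.continuousOn.integrableOn_compact (isCompact_closedBall x ε)).mono_set
    ball_subset_closedBall

lemma setAverage_ball_coord_sq (hn : 0 < n) {ε : ℝ} (hε : 0 < ε) (i : Fin n) :
    ⨍ z in ball (0 : En n) ε, z i * z i = ε ^ 2 / (n + 2) := by
  have hn' : (0 : ℝ) < n := by exact_mod_cast hn
  have h1 : ∫ z in ball (0 : En n) ε, ‖z‖ ^ 2
      = n * ∫ z in ball (0 : En n) ε, z i * z i := by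
    simp_rw [EuclideanSpace.real_norm_sq_eq, sq]
    rw [MeasureTheory.integral_finsetSum _ fun j _ => integrableOn_ball_of_continuous
      (F := fun z : En n => z j * z j) (by fun_prop) 0 ε]
    simp [setIntegral_ball_coord_sq _ i ε]
  have h2 := setIntegral_ball_norm_pow hn hε 0
  simp at h2
  have h3 := setIntegral_ball_norm_pow hn hε 2
  rw [h1] at h3
  have h4 : 0 < volume.real (ball (0 : En n) 1) := volume_real_ball_pos 0 one_pos
  have h5 : ∫ z in ball (0 : En n) ε, z i * z i
      = volume.real (ball (0 : En n) 1) * (ε ^ (n + 2) / (n + 2)) := by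
    rw [mul_assoc] at h3
    simpa using mul_left_cancel₀ hn'.ne' h3
  rw [setAverage_eq, h5, smul_eq_mul, h2]
  field_simp
  ring

lemma bilin_self_eq_sum (B : En n →L[ℝ] En n →L[ℝ] ℝ) (z : En n) :
    B z z = ∑ i, ∑ j, B (EuclideanSpace.basisFun (Fin n) ℝ i)
      (EuclideanSpace.basisFun (Fin n) ℝ j) * (z i * z j) := by
  have hz := (EuclideanSpace.basisFun (Fin n) ℝ).sum_repr z
  simp only [EuclideanSpace.basisFun_repr] at hz
  conv_lhs => rw [← hz]
  simp only [map_sum, map_smul, _root_.sum_apply, _root_.smul_apply,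
    smul_eq_mul, Finset.mul_sum]
  rw [Finset.sum_comm]
  exact Finset.sum_congr rfl fun i _ => Finset.sum_congr rfl fun j _ => by ring

lemma setIntegral_ball_inner (a : En n) (ε : ℝ) : ∫ z in ball (0 : En n) ε, ⟪a, z⟫ = 0 := by
  have h := setIntegral_ball_comp_linearIsometryEquiv (LinearIsometryEquiv.neg ℝ)
    (fun z : En n => ⟪a, z⟫) ε
  simp [integral_neg] at h
  linarith

lemma setAverage_ball_bilin (hn : 0 < n) {ε : ℝ} (hε : 0 < ε) (B : En n →L[ℝ] En n →L[ℝ] ℝ) :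
    ⨍ z in ball (0 : En n) ε, B z z = ε ^ 2 / (n + 2) * ∑ i,
      B (EuclideanSpace.basisFun (Fin n) ℝ i) (EuclideanSpace.basisFun (Fin n) ℝ i) := by
  have hintg : ∀ i j : Fin n, Integrable (fun z : En n => B (EuclideanSpace.basisFun (Fin n) ℝ i)
      (EuclideanSpace.basisFun (Fin n) ℝ j) * (z i * z j)) (volume.restrict (ball 0 ε)) :=
    fun i j => integrableOn_ball_of_continuous (by fun_prop) 0 ε
  rw [setAverage_eq, show (fun z => B z z) = _ from funext (bilin_self_eq_sum B)]
  rw [MeasureTheory.integral_finsetSum _ fun i _ => integrable_finsetSum _ fun j _ => hintg i j,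
    smul_eq_mul, Finset.mul_sum, Finset.mul_sum]
  refine Finset.sum_congr rfl fun i _ => ?_
  rw [MeasureTheory.integral_finsetSum _ fun j _ => hintg i j, Finset.sum_eq_single i]
  · have h := setAverage_ball_coord_sq hn hε i
    rw [setAverage_eq, smul_eq_mul] at h
    rw [integral_const_mul, ← h]
    ring
  · intro j _ hj
    rw [integral_const_mul, setIntegral_ball_coord_mul_coord hj.symm, mul_zero]
  · simp

lemma setAverage_ball_translate (F : En n → ℝ) (x : En n) (ε : ℝ) :
    ⨍ y in ball x ε, F y = ⨍ z in ball (0 : En n) ε, F (x + z) := by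
  have h := (measurePreserving_add_left volume x).setIntegral_preimage_emb
    (measurableEmbedding_addLeft x) F (ball x ε)
  have h2 := (measurePreserving_add_left volume x).measureReal_preimage
    (measurableSet_ball (x := x) (ε := ε)).nullMeasurableSet
  rw [preimage_add_ball, sub_self] at h h2
  rw [setAverage_eq, setAverage_eq, h, h2]

/-- Second-order upper bound for the average of a function over a ball. -/
lemma setAverage_ball_le (hn : 0 < n) {ε : ℝ} (hε : 0 < ε) {F : En n → ℝ} (hF : Continuous F)
    {x a : En n} {c : ℝ} {B : En n →L[ℝ] En n →L[ℝ] ℝ}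
    (h : ∀ z ∈ ball (0 : En n) ε, F (x + z) ≤ c + ⟪a, z⟫ + 1 / 2 * B z z) :
    ⨍ y in ball x ε, F y ≤ c + ε ^ 2 / (2 * (n + 2)) * ∑ i,
      B (EuclideanSpace.basisFun (Fin n) ℝ i) (EuclideanSpace.basisFun (Fin n) ℝ i) := by
  have hv : 0 < volume.real (ball (0 : En n) ε) := volume_real_ball_pos 0 hε
  have hB := setAverage_ball_bilin hn hε B
  rw [setAverage_eq, smul_eq_mul] at hB
  have h1 : Integrable (fun _ : En n => c) (volume.restrict (ball (0 : En n) ε)) :=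
    integrableOn_ball_of_continuous continuous_const 0 ε
  have h2 : Integrable (fun z : En n => ⟪a, z⟫) (volume.restrict (ball (0 : En n) ε)) :=
    integrableOn_ball_of_continuous (by fun_prop) 0 ε
  have h3 : Integrable (fun z : En n => 1 / 2 * B z z) (volume.restrict (ball (0 : En n) ε)) :=
    integrableOn_ball_of_continuous (by fun_prop) 0 ε
  have h12 : Integrable (fun z : En n => c + ⟪a, z⟫) (volume.restrict (ball (0 : En n) ε)) :=
    h1.add h2
  have h4 : ∫ z in ball (0 : En n) ε, F (x + z)
      ≤ ∫ z in ball (0 : En n) ε, (c + ⟪a, z⟫ + 1 / 2 * B z z) :=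
    setIntegral_mono_on (integrableOn_ball_of_continuous (by fun_prop) 0 ε)
      (h12.add h3) measurableSet_ball h
  rw [integral_add h12 h3, integral_add h1 h2, setIntegral_ball_inner, add_zero,
    setIntegral_const, smul_eq_mul, integral_const_mul] at h4
  rw [setAverage_ball_translate, setAverage_eq, smul_eq_mul]
  have h5 := mul_le_mul_of_nonneg_left h4 (inv_nonneg.2 hv.le)
  refine h5.trans (le_of_eq ?_)
  rw [mul_add, inv_mul_cancel_left₀ hv.ne', mul_left_comm, hB]
  field_simp

end BallAverages

section Consistency

variable {n : ℕ}

/-- Second-order Taylor expansion with a remainder which is uniform on a closed ball. -/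
lemma exists_taylor_remainder_le {w : En n → ℝ} (hw : ContDiff ℝ 2 w) (R : ℝ) {η : ℝ}
    (hη : 0 < η) :
    ∃ δ > 0, ∀ x ∈ closedBall (0 : En n) R, ∀ h : En n, ‖h‖ < δ →
      |w (x + h) - w x - fderiv ℝ w x h - 1 / 2 * fderiv ℝ (fderiv ℝ w) x h h|
        ≤ η * ‖h‖ ^ 2 := by
  have hw1 : ContDiff ℝ 1 (fderiv ℝ w) := hw.fderiv_right (by norm_num)
  have hw2 : Continuous (fderiv ℝ (fderiv ℝ w)) := hw1.continuous_fderiv (by norm_num)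
  have huc' : UniformContinuousOn (fderiv ℝ (fderiv ℝ w)) (closedBall 0 (R + 1)) :=
    (isCompact_closedBall (0 : En n) (R + 1)).uniformContinuousOn_of_continuous hw2.continuousOn
  obtain ⟨δ, hδ, huc⟩ :=
    (Metric.uniformContinuousOn_iff (β := En n →L[ℝ] En n →L[ℝ] ℝ)).1 huc' η hη
  refine ⟨min δ 1, by positivity, fun x hx h hh => ?_⟩
  rw [lt_min_iff] at hh
  rw [mem_closedBall_zero_iff] at hx
  have hB : ∀ y ∈ closedBall x ‖h‖, ‖fderiv ℝ (fderiv ℝ w) y - fderiv ℝ (fderiv ℝ w) x‖ ≤ η := by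
    intro y hy
    rw [mem_closedBall, dist_eq_norm] at hy
    refine le_of_eq_of_le (dist_eq_norm (E := En n →L[ℝ] En n →L[ℝ] ℝ) _ _).symm
      (huc y ?_ x ?_ ?_).le
    · rw [mem_closedBall_zero_iff]
      have := norm_sub_norm_le y x
      linarith
    · rw [mem_closedBall_zero_iff]
      linarith
    · rw [dist_eq_norm]
      linarith
  have hx0 : x ∈ closedBall x ‖h‖ := mem_closedBall_self (norm_nonneg h)
  have hsub : ∀ y : En n, HasFDerivAt (fun z : En n => z - x) (ContinuousLinearMap.id ℝ (En n)) y :=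
    fun y => (hasFDerivAt_id y).sub_const x
  have hfirst : ∀ y ∈ closedBall x ‖h‖,
      ‖fderiv ℝ w y - fderiv ℝ w x - fderiv ℝ (fderiv ℝ w) x (y - x)‖ ≤ η * ‖h‖ := by
    intro y hy
    have h1 := (convex_closedBall x ‖h‖).norm_image_sub_le_of_norm_hasFDerivWithin_le
      (f := fun z => fderiv ℝ w z - fderiv ℝ w x - fderiv ℝ (fderiv ℝ w) x (z - x))
      (f' := fun z => fderiv ℝ (fderiv ℝ w) z - fderiv ℝ (fderiv ℝ w) x)
      (fun z _ => by
        have h2 := ((hw1.differentiable (by norm_num) z).hasFDerivAt.sub_const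
          (fderiv ℝ w x)).sub ((fderiv ℝ (fderiv ℝ w) x).hasFDerivAt.comp z (hsub z))
        rw [ContinuousLinearMap.comp_id] at h2
        exact h2.hasFDerivWithinAt) hB hx0 hy
    rw [sub_self, sub_self, map_zero, sub_zero, sub_zero] at h1
    rw [mem_closedBall, dist_eq_norm] at hy
    exact h1.trans (mul_le_mul_of_nonneg_left hy hη.le)
  have hsymm : ∀ v v', fderiv ℝ (fderiv ℝ w) x v v' = fderiv ℝ (fderiv ℝ w) x v' v := fun v v' =>
    (hw.contDiffAt (x := x)).isSymmSndFDerivAt (by simp) v v'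
  have hy : x + h ∈ closedBall x ‖h‖ := by simp
  have h1 := (convex_closedBall x ‖h‖).norm_image_sub_le_of_norm_hasFDerivWithin_le
    (f := fun z => w z - fderiv ℝ w x (z - x)
      - 1 / 2 * fderiv ℝ (fderiv ℝ w) x (z - x) (z - x))
    (f' := fun z => fderiv ℝ w z - fderiv ℝ w x - fderiv ℝ (fderiv ℝ w) x (z - x))
    (fun z _ => by
      have h2 := (((hw.differentiable (by norm_num) z).hasFDerivAt).sub
        ((fderiv ℝ w x).hasFDerivAt.comp z (hsub z))).sub
        ((((fderiv ℝ (fderiv ℝ w) x).hasFDerivAt.comp z (hsub z)).clm_apply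
          (hsub z)).const_mul (1 / 2 : ℝ))
      refine HasFDerivAt.hasFDerivWithinAt (h2.congr_fderiv ?_)
      ext v
      simp
      rw [hsymm v z, hsymm v x]
      ring) hfirst hx0 hy
  simp only [sub_self, map_zero, sub_zero, add_sub_cancel_left, mul_zero, Real.norm_eq_abs] at h1
  rw [show w (x + h) - w x - fderiv ℝ w x h - 1 / 2 * fderiv ℝ (fderiv ℝ w) x h h
    = w (x + h) - fderiv ℝ w x h - 1 / 2 * fderiv ℝ (fderiv ℝ w) x h h - w x by ring]
  refine h1.trans (le_of_eq (by ring))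

lemma continuous_pSecond {w : En n → ℝ} (hw : ContDiff ℝ 2 w) (p : ℝ) :
    Continuous fun q : En n × En n => pSecond p w q.1 q.2 := by
  have hw2 : Continuous (fderiv ℝ (fderiv ℝ w)) :=
    (hw.fderiv_right (m := 1) (by norm_num)).continuous_fderiv (by norm_num)
  unfold pSecond laplacian secondDeriv
  fun_prop

lemma continuous_gradient_of_contDiff {w : En n → ℝ} (hw : ContDiff ℝ 2 w) :
    Continuous (gradient w) :=
  (InnerProductSpace.toDual ℝ (En n)).symm.continuous.comp (hw.continuous_fderiv (by norm_num))

/-- A bound on `pSecond` in the direction of the gradient persists, up to a small error, in all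
directions which almost maximize the directional derivative. -/
lemma exists_pSecond_le_of_inner_gradient {w : En n → ℝ} (hw : ContDiff ℝ 2 w) {p R : ℝ}
    {G : En n → ℝ} (hG : Continuous G)
    (H : ∀ x ∈ closedBall (0 : En n) R, ∀ v : En n, ‖v‖ ≤ 1 →
      (gradient w x ≠ 0 → v = ‖gradient w x‖⁻¹ • gradient w x) → pSecond p w x v ≤ G x)
    {σ : ℝ} (hσ : 0 < σ) :
    ∃ δ > 0, ∀ x ∈ closedBall (0 : En n) R, ∀ v : En n, ‖v‖ ≤ 1 →
      ‖gradient w x‖ - δ ≤ ⟪gradient w x, v⟫ → pSecond p w x v ≤ G x + σ := by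
  have hc := continuous_pSecond hw p
  have hgc := continuous_gradient_of_contDiff hw
  have hS : IsCompact ((closedBall (0 : En n) R ×ˢ closedBall (0 : En n) 1) ∩
      {q | G q.1 + σ ≤ pSecond p w q.1 q.2}) :=
    ((isCompact_closedBall _ _).prod (isCompact_closedBall _ _)).inter_right
      (isClosed_le (by fun_prop) hc)
  obtain ⟨a, ha, hle⟩ := hS.exists_forall_le'
    (f := fun q => ‖gradient w q.1‖ - ⟪gradient w q.1, q.2⟫) (a := 0) (by fun_prop) (by
      rintro ⟨x, v⟩ ⟨⟨hx, hv⟩, hq⟩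
      rw [mem_closedBall_zero_iff] at hv
      by_contra hcon
      refine absurd (H x hx v hv fun hgx => ?_)
        (not_le.2 (by linarith [show G x + σ ≤ pSecond p w x v from hq]))
      have hpos : 0 < ‖gradient w x‖ := norm_pos_iff.2 hgx
      rw [← sub_eq_zero, ← norm_eq_zero, ← sq_eq_zero_iff]
      refine le_antisymm ?_ (sq_nonneg _)
      rw [norm_sub_sq_real, real_inner_smul_right, norm_smul, norm_inv, norm_norm,
        inv_mul_cancel₀ hpos.ne', real_inner_comm]
      have h1 : ‖gradient w x‖ ≤ ⟪gradient w x, v⟫ := by simpa using hcon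
      have h2 : 1 ≤ ‖gradient w x‖⁻¹ * ⟪gradient w x, v⟫ := by
        rwa [← div_eq_inv_mul, one_le_div hpos]
      have h3 : ‖v‖ ^ 2 ≤ 1 := pow_le_one₀ (norm_nonneg v) hv
      linarith)
  refine ⟨a / 2, by positivity, fun x hx v hv hgv => ?_⟩
  by_contra hcon
  have := hle (x, v) ⟨⟨hx, by rwa [mem_closedBall_zero_iff]⟩, (not_le.1 hcon).le⟩
  simp only at this
  linarith

lemma bddBelow_image_ball {w : En n → ℝ} (hw : Continuous w) (x : En n) (ε : ℝ) :
    BddBelow (w '' ball x ε) :=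
  ((isCompact_closedBall x ε).bddBelow_image hw.continuousOn).mono
    (image_mono ball_subset_closedBall)

lemma bddAbove_image_ball {w : En n → ℝ} (hw : Continuous w) (x : En n) (ε : ℝ) :
    BddAbove (w '' ball x ε) :=
  ((isCompact_closedBall x ε).bddAbove_image hw.continuousOn).mono
    (image_mono ball_subset_closedBall)

lemma sInf_image_ball_le {w : En n → ℝ} (hw : Continuous w) {x y : En n} {ε : ℝ} (hε : 0 < ε)
    (hy : y ∈ closedBall x ε) : sInf (w '' ball x ε) ≤ w y := by
  have h : closure (ball x ε) ⊆ {z | sInf (w '' ball x ε) ≤ w z} :=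
    closure_minimal (fun z hz => csInf_le (bddBelow_image_ball hw x ε) (mem_image_of_mem w hz))
      (isClosed_le continuous_const hw)
  rw [closure_ball x hε.ne'] at h
  exact h hy

/-- Consistency of the dynamic programming principle: a `C²` supersolution satisfies the discrete
supersolution inequality up to an error `o(ε²)`. -/
lemma exists_dpp_le_of_pSecond_le (hn : 0 < n) {w : En n → ℝ} (hw : ContDiff ℝ 2 w) {p R : ℝ}
    (hp : 2 ≤ p) {G : En n → ℝ} (hG : Continuous G)
    (H : ∀ x ∈ closedBall (0 : En n) R, ∀ v : En n, ‖v‖ ≤ 1 →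
      (gradient w x ≠ 0 → v = ‖gradient w x‖⁻¹ • gradient w x) → pSecond p w x v ≤ G x)
    {σ : ℝ} (hσ : 0 < σ) :
    ∃ ε₀ > 0, ∀ ε, 0 < ε → ε < ε₀ → ∀ x ∈ closedBall (0 : En n) R,
      (p - 2) / (n + p) / 2 * (sSup (w '' ball x ε) + sInf (w '' ball x ε))
        + (n + 2) / (n + p) * (⨍ y in ball x ε, w y)
        ≤ w x + ε ^ 2 / (2 * (n + p)) * (G x + σ) := by
  have hw2 : Continuous (fderiv ℝ (fderiv ℝ w)) :=
    (hw.fderiv_right (m := 1) (by norm_num)).continuous_fderiv (by norm_num)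
  obtain ⟨K, hK⟩ : ∃ K, ∀ x ∈ closedBall (0 : En n) R, ‖fderiv ℝ (fderiv ℝ w) x‖ ≤ K :=
    (isCompact_closedBall (0 : En n) R).exists_bound_of_continuousOn
      (E := En n →L[ℝ] En n →L[ℝ] ℝ) hw2.continuousOn
  have hnp : (0 : ℝ) < n + p := by positivity
  set η : ℝ := σ / (4 * (n + p)) with hηdef
  have hη : 0 < η := by positivity
  obtain ⟨δ, hδ, hdir⟩ := exists_pSecond_le_of_inner_gradient hw hG H (half_pos hσ)
  obtain ⟨ε₁, hε₁, htaylor⟩ := exists_taylor_remainder_le hw R hη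
  refine ⟨min ε₁ (δ / (|K| + 2 * η)), by positivity, fun ε hε hεlt x hx => ?_⟩
  rw [lt_min_iff, lt_div_iff₀ (by positivity)] at hεlt
  obtain ⟨hεε₁, hεδ⟩ := hεlt
  set B := fderiv ℝ (fderiv ℝ w) x with hB
  set a := gradient w x with ha
  have hwc := hw.continuous
  have htay : ∀ h : En n, ‖h‖ ≤ ε → |w (x + h) - w x - ⟪a, h⟫ - 1 / 2 * B h h| ≤ η * ε ^ 2 := by
    intro h hh
    rw [ha, real_inner_gradient]
    refine (htaylor x hx h (hh.trans_lt hεε₁)).trans ?_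
    gcongr
  have hBle : ∀ h : En n, ‖h‖ ≤ ε → |B h h| ≤ |K| * ε ^ 2 := by
    intro h hh
    have h1 := B.le_opNorm₂ h h
    rw [Real.norm_eq_abs] at h1
    refine h1.trans ?_
    rw [mul_assoc, ← sq]
    have h2 : ‖B‖ ≤ |K| := (hK x hx).trans (le_abs_self K)
    gcongr
  obtain ⟨h, hh, hmax⟩ := (isCompact_closedBall (0 : En n) ε).exists_isMaxOn
    ⟨0, mem_closedBall_self hε.le⟩ (f := fun z => w (x + z)) (by fun_prop)
  have hmax' : ∀ z : En n, ‖z‖ ≤ ε → w (x + z) ≤ w (x + h) := fun z hz =>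
    hmax (by rwa [mem_closedBall_zero_iff])
  rw [mem_closedBall_zero_iff] at hh
  have hsup : sSup (w '' ball x ε) ≤ w (x + h) := by
    refine csSup_le ((nonempty_ball.2 hε).image w) ?_
    rintro _ ⟨y, hy, rfl⟩
    have := hmax' (y - x) (by rw [← dist_eq_norm]; exact (mem_ball.1 hy).le)
    rwa [add_sub_cancel] at this
  have hinf : sInf (w '' ball x ε) ≤ w (x + -h) :=
    sInf_image_ball_le hwc hε (by simpa using hh)
  have h1 := abs_le.1 (htay h hh)
  have h2 := abs_le.1 (htay (-h) (by rwa [norm_neg]))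
  rw [inner_neg_right, show B (-h) (-h) = B h h by simp] at h2
  have hhv : h = ε • (ε⁻¹ • h) := by rw [smul_inv_smul₀ hε.ne']
  set v := ε⁻¹ • h with hv
  have hv1 : ‖v‖ ≤ 1 := by
    rw [hv, norm_smul, norm_inv, Real.norm_eq_abs, abs_of_pos hε, inv_mul_le_iff₀ hε]
    linarith
  have hBv : B h h = ε ^ 2 * B v v := by
    rw [hhv]
    simp
    ring
  have hdirv : ‖a‖ - δ ≤ ⟪a, v⟫ := by
    have he : ‖ε • (‖a‖⁻¹ • a)‖ ≤ ε := by
      rw [norm_smul, norm_smul, norm_inv, norm_norm, Real.norm_eq_abs, abs_of_pos hε]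
      exact mul_le_of_le_one_right hε.le inv_mul_le_one
    have hae : ⟪a, ε • (‖a‖⁻¹ • a)⟫ = ε * ‖a‖ := by
      rw [real_inner_smul_right, real_inner_smul_right, real_inner_self_eq_norm_sq]
      rcases eq_or_ne ‖a‖ 0 with h0 | h0
      · simp [h0]
      · field_simp
    have hah : ⟪a, h⟫ = ε * ⟪a, v⟫ := by rw [hhv, real_inner_smul_right]
    have h3 := abs_le.1 (htay _ he)
    have h4 := abs_le.1 (hBle _ he)
    have h5 := abs_le.1 (hBle h hh)
    have h6 := hmax' _ he
    rw [hae] at h3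
    rw [hah] at h1
    have h7 : ε * ‖a‖ ≤ ε * (⟪a, v⟫ + ε * (|K| + 2 * η)) := by nlinarith
    have h8 := le_of_mul_le_mul_left h7 hε
    linarith
  have hps := hdir x hx v hv1 hdirv
  have hav := setAverage_ball_le hn hε hwc (x := x) (a := a) (c := w x + η * ε ^ 2) (B := B)
    fun z hz => by
      have := (abs_le.1 (htay z (mem_ball_zero_iff.1 hz).le)).2
      linarith
  have hss : sSup (w '' ball x ε) + sInf (w '' ball x ε)
      ≤ 2 * w x + ε ^ 2 * B v v + 2 * (η * ε ^ 2) := by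
    rw [hBv] at h1 h2
    linarith
  have hps' : (p - 2) * B v v + ∑ i, B (EuclideanSpace.basisFun (Fin n) ℝ i)
      (EuclideanSpace.basisFun (Fin n) ℝ i) ≤ G x + σ / 2 := hps
  set T := ∑ i, B (EuclideanSpace.basisFun (Fin n) ℝ i) (EuclideanSpace.basisFun (Fin n) ℝ i)
  have hα0 : 0 ≤ (p - 2) / (n + p) / 2 := by
    have : 0 ≤ p - 2 := by linarith
    positivity
  have hβ0 : 0 ≤ ((n : ℝ) + 2) / (n + p) := by positivity
  refine (add_le_add (mul_le_mul_of_nonneg_left hss hα0)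
    (mul_le_mul_of_nonneg_left hav hβ0)).trans ?_
  have h9 : (p - 2) / (n + p) / 2 * (2 * w x + ε ^ 2 * B v v + 2 * (η * ε ^ 2))
      + (n + 2) / (n + p) * (w x + η * ε ^ 2 + ε ^ 2 / (2 * (n + 2)) * T)
      = w x + ε ^ 2 / (2 * (n + p)) * ((p - 2) * B v v + T + σ / 2) := by
    rw [hηdef]
    field_simp
    ring
  rw [h9]
  exact add_le_add le_rfl (mul_le_mul_of_nonneg_left (by linarith) (by positivity))

end Consistency

section Comparison

variable {n : ℕ}

open scoped Pointwise in
lemma sSup_image_const_mul {a : ℝ} (ha : 0 ≤ a) (w : En n → ℝ) (s : Set (En n)) :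
    sSup ((fun x => a * w x) '' s) = a * sSup (w '' s) := by
  rw [← smul_eq_mul a (sSup _), ← Real.sSup_smul_of_nonneg ha, ← image_smul, image_image]
  rfl

open scoped Pointwise in
lemma sInf_image_const_mul {a : ℝ} (ha : 0 ≤ a) (w : En n → ℝ) (s : Set (En n)) :
    sInf ((fun x => a * w x) '' s) = a * sInf (w '' s) := by
  rw [← smul_eq_mul a (sInf _), ← Real.sInf_smul_of_nonneg ha, ← image_smul, image_image]
  rfl

lemma setAverage_const_mul (a : ℝ) (w : En n → ℝ) (s : Set (En n)) :
    ⨍ y in s, a * w y = a * ⨍ y in s, w y := by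
  rw [setAverage_eq, setAverage_eq, integral_const_mul, smul_eq_mul, smul_eq_mul, mul_left_comm]

open scoped Pointwise in
lemma SatisfiesDPP.neg {α β ε : ℝ} {Ω : Set (En n)} {F V : En n → ℝ}
    (h : SatisfiesDPP n α β ε Ω F V) :
    SatisfiesDPP n α β ε Ω (fun x => -F x) (fun x => -V x) := by
  intro x hx
  have h1 : (fun y => -V y) '' ball x ε = -(V '' ball x ε) := by
    rw [← image_neg_eq_neg, image_image]
  rw [h1, Real.sSup_neg, Real.sInf_neg, average_neg]
  linarith [h x hx]

/-- Comparison of a bounded solution of the dynamic programming principle with a continuous strict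
discrete supersolution. -/
lemma SatisfiesDPP.le_add_of_strict_supersolution {α β ε κ m R : ℝ} (hα : 0 ≤ α) (hβ : 0 ≤ β)
    (hαβ : α + β = 1) (hε : 0 < ε) (hκ : 0 < κ) {Γ : Set (En n)} {F V W : En n → ℝ}
    (hV : SatisfiesDPP n α β ε (ball 0 R) F V) (hVm : Measurable V)
    (hVb : ∃ M, ∀ x ∈ ball (0 : En n) R ∪ Γ, |V x| ≤ M)
    (hsub : ∀ x ∈ ball (0 : En n) R, ball x ε ⊆ ball 0 R ∪ Γ)
    (hW : Continuous W) (hWb : ∃ M, ∀ x ∈ ball (0 : En n) R ∪ Γ, |W x| ≤ M)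
    (hWs : ∀ x ∈ ball (0 : En n) R, α / 2 * (sSup (W '' ball x ε) + sInf (W '' ball x ε))
      + β * (⨍ y in ball x ε, W y) + ε ^ 2 * F x + κ ≤ W x)
    (hΓ : ∀ x ∈ Γ, V x ≤ W x + m) {x : En n} (hx : x ∈ ball (0 : En n) R) :
    V x ≤ W x + m := by
  obtain ⟨M₁, hM₁⟩ := hVb
  obtain ⟨M₂, hM₂⟩ := hWb
  set E : Set (En n) := ball 0 R ∪ Γ
  have hbdd : BddAbove ((fun y => V y - W y) '' E) := by
    refine ⟨M₁ + M₂, ?_⟩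
    rintro _ ⟨y, hy, rfl⟩
    have h1 := abs_le.1 (hM₁ y hy)
    have h2 := abs_le.1 (hM₂ y hy)
    change V y - W y ≤ _
    linarith
  set S : ℝ := sSup ((fun y => V y - W y) '' E)
  have hS : ∀ y ∈ E, V y ≤ W y + S := fun y hy => by
    have := le_csSup hbdd (mem_image_of_mem _ hy)
    change V y - W y ≤ S at this
    linarith
  have hstep : ∀ y ∈ ball (0 : En n) R, V y ≤ W y + (S - κ) := by
    intro y hy
    have hyE := hsub y hy
    have hne : (ball y ε).Nonempty := nonempty_ball.2 hε
    have hbelow : BddBelow (V '' ball y ε) := by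
      refine ⟨-M₁, ?_⟩
      rintro _ ⟨z, hz, rfl⟩
      exact (abs_le.1 (hM₁ z (hyE hz))).1
    have h1 : sSup (V '' ball y ε) ≤ sSup (W '' ball y ε) + S := by
      refine csSup_le (hne.image V) ?_
      rintro _ ⟨z, hz, rfl⟩
      have := le_csSup (bddAbove_image_ball hW y ε) (mem_image_of_mem W hz)
      linarith [hS z (hyE hz)]
    have h2 : sInf (V '' ball y ε) - S ≤ sInf (W '' ball y ε) := by
      refine le_csInf (hne.image W) ?_
      rintro _ ⟨z, hz, rfl⟩
      have := csInf_le hbelow (mem_image_of_mem V hz)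
      linarith [hS z (hyE hz)]
    have hv : 0 < volume.real (ball y ε) := volume_real_ball_pos y hε
    have hVi : IntegrableOn V (ball y ε) :=
      Measure.integrableOn_of_bounded measure_ball_lt_top.ne hVm.aestronglyMeasurable
        (ae_restrict_of_forall_mem measurableSet_ball fun z hz => hM₁ z (hyE hz))
    have hWi : IntegrableOn W (ball y ε) := integrableOn_ball_of_continuous hW y ε
    have hSi : IntegrableOn (fun _ : En n => S) (ball y ε) :=
      integrableOn_ball_of_continuous continuous_const y ε
    have h3 : ⨍ z in ball y ε, V z ≤ (⨍ z in ball y ε, W z) + S := by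
      have h4 : ∫ z in ball y ε, V z ≤ ∫ z in ball y ε, (W z + S) :=
        setIntegral_mono_on hVi (hWi.add hSi) measurableSet_ball fun z hz => hS z (hyE hz)
      rw [integral_add hWi hSi, setIntegral_const, smul_eq_mul] at h4
      rw [setAverage_eq, setAverage_eq, smul_eq_mul, smul_eq_mul]
      refine (mul_le_mul_of_nonneg_left h4 (inv_nonneg.2 hv.le)).trans (le_of_eq ?_)
      rw [mul_add, inv_mul_cancel_left₀ hv.ne']
    have h5 := hV y hy
    have h6 := hWs y hy
    have h7 : α / 2 * (sSup (V '' ball y ε) + sInf (V '' ball y ε))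
        ≤ α / 2 * (sSup (W '' ball y ε) + S + (sInf (W '' ball y ε) + S)) :=
      mul_le_mul_of_nonneg_left (by linarith) (by positivity)
    have h8 := mul_le_mul_of_nonneg_left h3 hβ
    have h9 : α * S + β * S = S := by rw [← add_mul, hαβ, one_mul]
    linarith
  have hSm : S ≤ max m (S - κ) := by
    refine csSup_le ⟨_, mem_image_of_mem _ (Or.inl hx)⟩ ?_
    rintro _ ⟨y, hy | hy, rfl⟩
    · exact le_max_of_le_right (by linarith [hstep y hy])
    · exact le_max_of_le_left (by linarith [hΓ y hy])
  have hSm' : S ≤ m := by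
    rcases le_max_iff.1 hSm with h | h <;> linarith
  linarith [hS x (Or.inl hx)]

/-- One-sided convergence of solutions of the dynamic programming principle to a viscosity
supersolution whose right-hand side does not vanish. -/
lemma IsViscositySupersolution.eventually_le_add (hn : 0 < n) {p R R₁ R₂ r₀ : ℝ} (hp : 2 < p)
    (hR : R < R₁) (hR₁ : R₁ < R₂) {u g : En n → ℝ} (hu : Continuous u) {M : ℝ}
    (hM : ∀ x, |u x| ≤ M) (hg : Continuous g)
    (hsup : IsViscositySupersolution p (ball (0 : En n) R₂) g u)
    (hsign : (∀ x ∈ closedBall (0 : En n) R₁, 0 < g x) ∨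
      ∀ x ∈ closedBall (0 : En n) R₁, g x < 0)
    {Γ : ℝ → Set (En n)} {V : ℝ → En n → ℝ} (hr₀ : 0 < r₀)
    (hΓ : ∀ ε, 0 < ε → ε < r₀ → Γ ε ⊆ closedBall 0 R₁)
    (hsub : ∀ ε, 0 < ε → ε < r₀ → ∀ x ∈ ball (0 : En n) R, ball x ε ⊆ ball 0 R ∪ Γ ε)
    (hVm : ∀ ε, 0 < ε → ε < r₀ → Measurable (V ε))
    (hVb : ∀ ε, 0 < ε → ε < r₀ → ∃ M, ∀ x ∈ ball (0 : En n) R ∪ Γ ε, |V ε x| ≤ M)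
    (hVΓ : ∀ ε, 0 < ε → ε < r₀ → EqOn (V ε) u (Γ ε))
    (hV : ∀ ε, 0 < ε → ε < r₀ → SatisfiesDPP n ((p - 2) / (n + p)) ((n + 2) / (n + p)) ε
      (ball 0 R) (fun x => p / (2 * (n + p)) * g x) (V ε)) {η : ℝ} (hη : 0 < η) :
    ∃ ε₀ > 0, ∀ ε, 0 < ε → ε < ε₀ → ∀ x ∈ ball (0 : En n) R, V ε x ≤ u x + η := by
  have hM0 : 0 ≤ M := (abs_nonneg _).trans (hM 0)
  have hnp : (0 : ℝ) < n + p := by positivity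
  obtain ⟨g₀, hg₀, hgle⟩ := (isCompact_closedBall (0 : En n) R₁).exists_forall_le'
    (f := fun x => |g x|) (a := 0) hg.abs.continuousOn fun x hx => abs_pos.2 <| by
      rcases hsign with h | h
      · exact (h x hx).ne'
      · exact (h x hx).ne
  obtain ⟨τ, hτ, hτ1, hτη⟩ : ∃ τ : ℝ, 0 < τ ∧ τ ≤ 1 / 2 ∧ τ * (p * g₀ + 2 * M) ≤ η := by
    refine ⟨min (1 / 2) (η / (p * g₀ + 2 * M)), by positivity, min_le_left _ _, ?_⟩
    rw [← le_div_iff₀ (by positivity)]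
    exact min_le_right _ _
  obtain ⟨l, hl0, hl2, hl1, hlg⟩ : ∃ l : ℝ, 0 < l ∧ l ≤ 2 ∧ |l - 1| ≤ τ ∧
      ∀ x ∈ closedBall (0 : En n) R₁, τ * g₀ ≤ (l - 1) * g x := by
    rcases hsign with h | h
    · refine ⟨1 + τ, by linarith, by linarith, by simp [abs_of_pos hτ], fun x hx => ?_⟩
      have := hgle x hx
      rw [abs_of_pos (h x hx)] at this
      nlinarith
    · refine ⟨1 - τ, by linarith, by linarith, by simp [abs_of_pos hτ], fun x hx => ?_⟩
      have := hgle x hx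
      rw [abs_of_neg (h x hx)] at this
      nlinarith
  set σ : ℝ := τ * p * g₀ / 8 with hσdef
  have hσ : 0 < σ := by positivity
  obtain ⟨w, hw, hwu, hpw⟩ := hsup.exists_smooth_approximation hp.le hR hR₁ hu hM hg
    (hsign.imp id fun h x hx => (h x hx).le) hσ
  have hlw : ∀ x ∈ closedBall (0 : En n) R₁, |l * w x - u x| ≤ 2 * σ + τ * M := by
    intro x hx
    have h1 : l * w x - u x = l * (w x - u x) + (l - 1) * u x := by ring
    rw [h1]
    refine (abs_add_le _ _).trans (add_le_add ?_ ?_)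
    · rw [abs_mul, abs_of_pos hl0]
      exact mul_le_mul hl2 (hwu x hx) (abs_nonneg _) (by norm_num)
    · rw [abs_mul]
      exact mul_le_mul hl1 (hM x) (abs_nonneg _) hτ.le
  obtain ⟨ε₁, hε₁, hcons⟩ := exists_dpp_le_of_pSecond_le hn hw hp.le
    (G := fun x => -(p * g x) + σ) (by fun_prop) hpw hσ
  have hball : ball (0 : En n) R ⊆ closedBall 0 R₁ :=
    ball_subset_closedBall.trans (closedBall_subset_closedBall hR.le)
  have hwc : Continuous fun x => l * w x := continuous_const.mul hw.continuous
  refine ⟨min ε₁ r₀, by positivity, fun ε hε hεlt x hx => ?_⟩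
  rw [lt_min_iff] at hεlt
  have hsubset : ball (0 : En n) R ∪ Γ ε ⊆ closedBall 0 R₁ := union_subset hball (hΓ ε hε hεlt.2)
  have hfinal := (hV ε hε hεlt.2).le_add_of_strict_supersolution
    (κ := ε ^ 2 / (2 * (n + p)) * (4 * σ)) (m := 2 * σ + τ * M)
    (div_nonneg (by linarith) hnp.le) (by positivity)
    (by field_simp; ring) hε (by positivity) (hVm ε hε hεlt.2) (hVb ε hε hεlt.2)
    (hsub ε hε hεlt.2) hwc
    (by
      obtain ⟨C, hC⟩ := (isCompact_closedBall (0 : En n) R₁).exists_bound_of_continuousOn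
        hwc.continuousOn
      exact ⟨C, fun y hy => hC y (hsubset hy)⟩)
    (fun y hy => by
      have h1 := hcons ε hε hεlt.1 y (ball_subset_closedBall hy)
      have h2 := hlg y (hball hy)
      rw [sSup_image_const_mul hl0.le, sInf_image_const_mul hl0.le, setAverage_const_mul]
      have h3 := mul_le_mul_of_nonneg_left h1 hl0.le
      have h4 : l * (-(p * g y) + σ + σ) + p * g y + 4 * σ ≤ 0 := by
        have h5 : p * (τ * g₀) ≤ p * ((l - 1) * g y) := by gcongr
        have h6 : l * σ ≤ 2 * σ := by gcongr
        have h7 : p * (τ * g₀) = 8 * σ := by rw [hσdef]; ring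
        linarith
      have h8 : ε ^ 2 / (2 * (n + p)) * (l * (-(p * g y) + σ + σ) + p * g y + 4 * σ) ≤ 0 :=
        mul_nonpos_of_nonneg_of_nonpos (by positivity) h4
      have h9 : ε ^ 2 * (p / (2 * (n + p)) * g y) = ε ^ 2 / (2 * (n + p)) * (p * g y) := by
        field_simp
      rw [h9]
      linarith)
    (fun y hy => by
      have h1 := (abs_le.1 (hlw y (hΓ ε hε hεlt.2 hy))).1
      rw [hVΓ ε hε hεlt.2 hy]
      linarith) hx
  have h1 := (abs_le.1 (hlw x (hball hx))).2
  have h2 : 4 * σ + 2 * (τ * M) ≤ η := by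
    have : 0 ≤ τ * p * g₀ := by positivity
    linarith
  linarith

end Comparison

section Convergence

variable {n : ℕ}

lemma normalizedPLaplacian_neg {p : ℝ} (φ : En n → ℝ) (x : En n) :
    normalizedPLaplacian n p (fun y => -φ y) x = -normalizedPLaplacian n p φ x := by
  have h1 : fderiv ℝ (fun y => -φ y) = fun y => -fderiv ℝ φ y := funext fun y => fderiv_fun_neg
  have h2 : gradient (fun y => -φ y) x = -gradient φ x := by
    rw [gradient, gradient, h1, map_neg]
  have h3 : ∀ v w, secondDeriv n (fun y => -φ y) x v w = -secondDeriv n φ x v w := by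
    intro v w
    rw [secondDeriv, h1, fderiv_fun_neg]
    rfl
  have h4 : laplacian n (fun y => -φ y) x = -laplacian n φ x := by
    simp only [laplacian, h3, Finset.sum_neg_distrib]
  rw [normalizedPLaplacian, normalizedPLaplacian, h2, h4, h3]
  by_cases h : gradient φ x = 0
  · simp [h]
  · rw [if_neg (neg_ne_zero.2 h), if_neg h, norm_neg]
    simp only [secondDeriv, map_neg, neg_apply]
    ring

lemma IsViscositySolution.isViscositySupersolution_neg {p : ℝ} {Ω : Set (En n)}
    {f u : En n → ℝ} (hu : IsViscositySolution n p Ω f u) :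
    IsViscositySupersolution p Ω (fun x => -f x) (fun x => -u x) := by
  intro x hx φ hφ hxu hle hgrad
  have h1 : gradient (fun y => -φ y) x = -gradient φ x := by
    rw [gradient, gradient, fderiv_fun_neg, map_neg]
  have h2 : fderiv ℝ (fderiv ℝ fun y => -φ y) x = -fderiv ℝ (fderiv ℝ φ) x := by
    have : fderiv ℝ (fun y => -φ y) = fun y => -fderiv ℝ φ y := funext fun y => fderiv_fun_neg
    rw [this, fderiv_fun_neg]
  have h3 := hu.2.2 x hx (fun y => -φ y) hφ.neg (by rw [hxu, neg_neg])
    (hle.mono fun y hy => by linarith) (by rwa [h1, h2, neg_ne_zero, neg_eq_zero])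
  rw [normalizedPLaplacian_neg] at h3
  linarith

/-- Viscosity supersolutions are determined by local data. -/
lemma IsViscositySupersolution.congr {p : ℝ} {Ω U : Set (En n)} {f g u v : En n → ℝ}
    (h : IsViscositySupersolution p Ω f u) (hU : IsOpen U) (hUΩ : U ⊆ Ω) (hfg : EqOn g f U)
    (huv : EqOn v u U) : IsViscositySupersolution p U g v := by
  intro x hx φ hφ hxv hle hgrad
  rw [hfg hx]
  refine h x (hUΩ hx) φ hφ (hxv.trans (huv hx)) ?_ hgrad
  filter_upwards [hle, hU.mem_nhds hx] with y hy hyU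
  rwa [← huv hyU]

/-- The radial retraction onto a closed ball centred at the origin. -/
def ballRetraction (r : ℝ) (x : En n) : En n := (r / max r ‖x‖) • x

lemma continuous_ballRetraction {r : ℝ} (hr : 0 < r) :
    Continuous (ballRetraction r : En n → En n) := by
  unfold ballRetraction
  exact (continuous_const.div (continuous_const.max continuous_norm) fun x =>
    (lt_max_of_lt_left hr).ne').smul continuous_id

lemma ballRetraction_mem {r : ℝ} (hr : 0 < r) (x : En n) :
    ballRetraction r x ∈ closedBall 0 r := by
  have h : 0 < max r ‖x‖ := lt_max_of_lt_left hr
  rw [mem_closedBall_zero_iff, ballRetraction, norm_smul, Real.norm_of_nonneg (by positivity),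
    div_mul_eq_mul_div, div_le_iff₀ h]
  exact mul_le_mul_of_nonneg_left (le_max_right _ _) hr.le

lemma ballRetraction_of_mem {r : ℝ} (hr : 0 < r) {x : En n} (hx : x ∈ closedBall 0 r) :
    ballRetraction r x = x := by
  rw [mem_closedBall_zero_iff] at hx
  rw [ballRetraction, max_eq_left hx, div_self hr.ne', one_smul]

lemma infDist_sphere_zero {R : ℝ} (hR : 0 ≤ R) (hn : 0 < n) (x : En n) :
    infDist x (sphere 0 R) = |‖x‖ - R| := by
  have : Nonempty (Fin n) := ⟨⟨0, hn⟩⟩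
  have hne : (sphere (0 : En n) R).Nonempty := NormedSpace.sphere_nonempty.2 hR
  apply le_antisymm
  · obtain rfl | hx := eq_or_ne x 0
    · obtain ⟨z, hz⟩ := hne
      refine (infDist_le_dist_of_mem hz).trans ?_
      rw [mem_sphere] at hz
      rw [dist_comm, hz, norm_zero, zero_sub, abs_neg]
      exact le_abs_self R
    · have hx' : 0 < ‖x‖ := norm_pos_iff.2 hx
      have hz : (R / ‖x‖) • x ∈ sphere (0 : En n) R := by
        rw [mem_sphere_zero_iff_norm, norm_smul, Real.norm_of_nonneg (by positivity),
          div_mul_cancel₀ _ hx'.ne']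
      refine (infDist_le_dist_of_mem hz).trans (le_of_eq ?_)
      have h1 : x - (R / ‖x‖) • x = ((‖x‖ - R) / ‖x‖) • x := by
        rw [sub_div, div_self hx'.ne', sub_smul, one_smul]
      rw [dist_eq_norm, h1, norm_smul, norm_div, norm_norm, div_mul_cancel₀ _ hx'.ne',
        Real.norm_eq_abs]
  · refine (le_infDist hne).2 fun y hy => ?_
    rw [← mem_sphere_zero_iff_norm.1 hy, dist_eq_norm]
    exact abs_norm_sub_norm_le x y

lemma ballStrip_subset_closedBall {Ω : Set (En n)} {R ε : ℝ} (hn : 0 < n) (hR : 0 ≤ R) :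
    ballStrip n Ω R ε ⊆ closedBall 0 (R + ε) := by
  rintro x ⟨-, -, hx⟩
  rw [infDist_sphere_zero hR hn] at hx
  rw [mem_closedBall_zero_iff]
  linarith [le_abs_self (‖x‖ - R)]

lemma mem_ballStrip {Ω : Set (En n)} {R ε : ℝ} (hn : 0 < n) (hR : 0 ≤ R) {x : En n}
    (hxΩ : x ∈ Ω) (hRx : R ≤ ‖x‖) (hx : ‖x‖ ≤ R + ε) : x ∈ ballStrip n Ω R ε := by
  refine ⟨hxΩ, by simpa using hRx, ?_⟩
  rw [infDist_sphere_zero hR hn, abs_of_nonneg (by linarith)]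
  linarith

end Convergence

/-- Lemma 5.4. A continuous viscosity solution `u` of `−Δ_p^N u = f`
is approximated uniformly on `B̄_R(0)` by the bounded Borel solutions `u_ε` of the DPP in
`B_R(0)` with boundary data `u` on `Γ_ε^R` and running payoff `f̄ = (pβ/(2(n+2))) f`. -/
theorem viscosity_solution_uniform_approximation
    (n : ℕ) (hn : 2 ≤ n) (Ω : Set (En n))
    (hΩopen : IsOpen Ω) (hΩbdd : Bornology.IsBounded Ω) (hΩconn : IsConnected Ω)
    (p : ℝ) (hp : 2 < p)
    (α β : ℝ) (hα : α = (p - 2) / (n + p)) (hβ : β = (n + 2) / (n + p))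
    (f : En n → ℝ) (hfcont : ContinuousOn f (closure Ω))
    (hfbdd : ∃ M, ∀ x ∈ closure Ω, |f x| ≤ M) (hfpos : ∀ x ∈ closure Ω, 0 < f x)
    (u : En n → ℝ) (hu : IsViscositySolution n p Ω f u)
    (R : ℝ) (hR : 0 < R) (hball : Metric.ball (0 : En n) (2 * R) ⊆ Ω)
    (uε : ℝ → En n → ℝ)
    (huε : ∀ ε : ℝ, 0 < ε → ε < R →
      Measurable (uε ε) ∧
      (∃ M, ∀ x ∈ Metric.ball (0 : En n) R ∪ ballStrip n Ω R ε, |uε ε x| ≤ M) ∧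
      Set.EqOn (uε ε) u (ballStrip n Ω R ε) ∧
      SatisfiesDPP n α β ε (Metric.ball (0 : En n) R)
        (fun x => p * β / (2 * (n + 2)) * f x) (uε ε)) :
    TendstoUniformlyOn (fun ε => uε ε) u (nhdsWithin 0 (Set.Ioo 0 R))
      (Metric.closedBall (0 : En n) R) := by
  have hn0 : 0 < n := by omega
  have hnp : (0 : ℝ) < n + p := by positivity
  have hpos : (0 : ℝ) < 3 * R / 2 := by positivity
  have hK : closedBall (0 : En n) (3 * R / 2) ⊆ Ω :=
    (closedBall_subset_ball (by linarith)).trans hball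
  have hKopen : ball (0 : En n) (3 * R / 2) ⊆ closedBall 0 (3 * R / 2) := ball_subset_closedBall
  have hρ := continuous_ballRetraction (n := n) hpos
  have hρK := ballRetraction_mem (n := n) hpos
  have hext : ∀ w : En n → ℝ, EqOn (w ∘ ballRetraction (3 * R / 2)) w (closedBall 0 (3 * R / 2)) :=
    fun w x hx => congrArg w (ballRetraction_of_mem hpos hx)
  set v := u ∘ ballRetraction (3 * R / 2) with hv
  set g := f ∘ ballRetraction (3 * R / 2) with hg
  have hvc : Continuous v := (hu.1.mono hK).comp_continuous hρ hρK
  have hgc : Continuous g := (hfcont.mono (hK.trans subset_closure)).comp_continuous hρ hρK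
  obtain ⟨M, hM⟩ := (isCompact_closedBall (0 : En n) (3 * R / 2)).exists_bound_of_continuousOn
    (hu.1.mono hK)
  have hvM : ∀ x, |v x| ≤ M := fun x => hM _ (hρK x)
  have hgpos : ∀ x, 0 < g x := fun x => hfpos _ (subset_closure (hK (hρK x)))
  have hsup : IsViscositySupersolution p (ball 0 (3 * R / 2)) g v :=
    IsViscositySupersolution.congr hu.2.1 isOpen_ball (hKopen.trans hK)
      ((hext f).mono hKopen) ((hext u).mono hKopen)
  have hsup' : IsViscositySupersolution p (ball 0 (3 * R / 2)) (fun x => -g x) (fun x => -v x) :=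
    hu.isViscositySupersolution_neg.congr isOpen_ball (hKopen.trans hK)
      (fun x hx => congrArg Neg.neg (hext f (hKopen hx)))
      (fun x hx => congrArg Neg.neg (hext u (hKopen hx)))
  have hR₁ : R < 5 * R / 4 := by linarith
  have hR₂ : 5 * R / 4 < 3 * R / 2 := by linarith
  have hr₀ : 0 < R / 4 := by positivity
  have hΓ : ∀ ε, 0 < ε → ε < R / 4 → ballStrip n Ω R ε ⊆ closedBall 0 (5 * R / 4) :=
    fun ε _ hε => (ballStrip_subset_closedBall hn0 hR.le).trans
      (closedBall_subset_closedBall (by linarith))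
  have hsub : ∀ ε, 0 < ε → ε < R / 4 → ∀ x ∈ ball (0 : En n) R,
      ball x ε ⊆ ball 0 R ∪ ballStrip n Ω R ε := by
    intro ε hε hεR x hx y hy
    rw [mem_ball_zero_iff] at hx
    rw [mem_ball, dist_eq_norm] at hy
    have hyn : ‖y‖ ≤ R + ε := by linarith [norm_sub_norm_le y x]
    by_cases hyR : ‖y‖ < R
    · exact Or.inl (mem_ball_zero_iff.2 hyR)
    · exact Or.inr (mem_ballStrip hn0 hR.le
        (hball (mem_ball_zero_iff.2 (by linarith))) (not_lt.1 hyR) hyn)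
  have hlt : ∀ ε, ε < R / 4 → ε < R := fun ε h => by linarith
  have hbd : ∀ ε, 0 < ε → ε < R / 4 → EqOn (uε ε) v (ballStrip n Ω R ε) := fun ε h0 h1 x hx =>
    ((huε ε h0 (hlt ε h1)).2.2.1 hx).trans
      (hext u (closedBall_subset_closedBall hR₂.le (hΓ ε h0 h1 hx))).symm
  have hdpp : ∀ ε, 0 < ε → ε < R / 4 → SatisfiesDPP n ((p - 2) / (n + p)) ((n + 2) / (n + p)) ε
      (ball 0 R) (fun x => p / (2 * (n + p)) * g x) (uε ε) := by
    intro ε h0 h1 x hx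
    have h2 : g x = f x :=
      hext f (closedBall_subset_closedBall (by linarith) (ball_subset_closedBall hx))
    have h3 : p * ((n + 2) / (n + p)) / (2 * (n + 2)) = p / (2 * (n + p)) := by field_simp
    have h4 := (huε ε h0 (hlt ε h1)).2.2.2 x hx
    simp only [hα, hβ, h3] at h4
    simp only [h2, h4]
  rw [Metric.tendstoUniformlyOn_iff]
  intro η hη
  obtain ⟨ε₁, hε₁, h₁⟩ := hsup.eventually_le_add hn0 hp hR₁ hR₂ hvc hvM hgc
    (Or.inl fun x _ => hgpos x) hr₀ hΓ hsub (fun ε h0 h1 => (huε ε h0 (hlt ε h1)).1)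
    (fun ε h0 h1 => (huε ε h0 (hlt ε h1)).2.1) hbd hdpp (half_pos hη)
  obtain ⟨ε₂, hε₂, h₂⟩ := hsup'.eventually_le_add (V := fun ε x => -uε ε x)
    (u := fun x => -v x) (g := fun x => -g x) hn0 hp hR₁ hR₂
    hvc.neg (fun x => (abs_neg (v x)).trans_le (hvM x)) hgc.neg
    (Or.inr fun x _ => neg_neg_of_pos (hgpos x)) hr₀ hΓ hsub
    (fun ε h0 h1 => (huε ε h0 (hlt ε h1)).1.neg)
    (fun ε h0 h1 => by simpa only [abs_neg] using (huε ε h0 (hlt ε h1)).2.1)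
    (fun ε h0 h1 x hx => congrArg Neg.neg (hbd ε h0 h1 hx))
    (fun ε h0 h1 => by simpa only [mul_neg] using (hdpp ε h0 h1).neg) (half_pos hη)
  have hmin : 0 < min ε₁ ε₂ := lt_min hε₁ hε₂
  filter_upwards [self_mem_nhdsWithin, mem_nhdsWithin_of_mem_nhds (Iio_mem_nhds hmin)]
    with ε hε hεlt x hx
  rw [mem_Iio, lt_min_iff] at hεlt
  rw [mem_closedBall_zero_iff] at hx
  rcases hx.lt_or_eq with hxR | hxR
  · have hxb : x ∈ ball (0 : En n) R := mem_ball_zero_iff.2 hxR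
    have h3 := h₁ ε hε.1 hεlt.1 x hxb
    have h4 := h₂ ε hε.1 hεlt.2 x hxb
    have h5 : v x = u x := hext u (mem_closedBall_zero_iff.2 (by linarith))
    rw [h5] at h3 h4
    rw [Real.dist_eq, abs_lt]
    constructor <;> linarith
  · have hxΓ : x ∈ ballStrip n Ω R ε := mem_ballStrip hn0 hR.le
      (hball (mem_ball_zero_iff.2 (by linarith))) hxR.ge (by linarith [hε.1])
    rwa [(huε ε hε.1 hε.2).2.2.1 hxΓ, dist_self]
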